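/- arXiv:2308.11586 — 2 statements merged into one kernel-verified Lean document; each statement's English description precedes it below -/
import Mathlib

section
/- Let 𝒜 be an uncountable almost disjoint family of infinite subsets of ℕ, and let X_𝒜 be the closed linear span in ℓ∞ of the indicator functions 1_A for A ∈ 𝒜 together with the indicator functions 1_{{n}} for n ∈ ℕ. Suppose that X_𝒜 admits few operators, i.e., every bounded linear operator T on X_𝒜 can be written as T = λ·I + U∘V for some scalar λ and bounded linear operators V : X_𝒜 → c₀ and U : c₀ → X_𝒜. Then every homomorphism from the Banach algebra B(X_𝒜) of bounded linear operators on X_𝒜 into a Banach algebra is continuous and has closed range. -/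
open scoped ENNReal ZeroAtInfty

set_option synthInstance.maxHeartbeats 1000000
set_option maxHeartbeats 1000000

/-- The indicator function of a set `A ⊆ ℕ`, viewed as an element of `ℓ∞`. -/
noncomputable def indLinf (𝕜 : Type*) [RCLike 𝕜] (A : Set ℕ) : lp (fun _ : ℕ => 𝕜) ∞ :=
  ⟨A.indicator fun _ => 1, memℓp_infty ⟨1, by
    rintro x ⟨n, rfl⟩
    by_cases h : n ∈ A <;> simp [Set.indicator, h]⟩⟩

/-- The space `X_𝒜`: the closed linear span in `ℓ∞` of the indicator functions `1_A` for
`A ∈ 𝒜` together with the indicator functions `1_{{n}}` for `n ∈ ℕ`. -/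
noncomputable def XA (𝕜 : Type*) [RCLike 𝕜] (𝒜 : Set (Set ℕ)) :
    Submodule 𝕜 (lp (fun _ : ℕ => 𝕜) ∞) :=
  (Submodule.span 𝕜 ((fun A => indLinf 𝕜 A) '' 𝒜 ∪
      Set.range fun n : ℕ => indLinf 𝕜 {n})).topologicalClosure

open Filter Topology

section SequenceSpace

variable {𝕜 : Type*} [RCLike 𝕜] {E F : Type*} [NormedAddCommGroup E] [NormedSpace 𝕜 E]
  [NormedAddCommGroup F] [NormedSpace 𝕜 F]

theorem norm_apply_le_norm_zeroAtInfty (c : C₀(ℕ, 𝕜)) (n : ℕ) : ‖c n‖ ≤ ‖c‖ :=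
  c.toBCF.norm_coe_le_norm n

theorem norm_zeroAtInfty_le {c : C₀(ℕ, 𝕜)} {M : ℝ} (hM : 0 ≤ M) (h : ∀ n, ‖c n‖ ≤ M) :
    ‖c‖ ≤ M :=
  (BoundedContinuousFunction.norm_le (f := c.toBCF) hM).2 h

theorem tendsto_zeroAtInfty_atTop (c : C₀(ℕ, 𝕜)) : Tendsto (fun n => c n) atTop (𝓝 0) := by
  have h := c.zero_at_infty'
  rwa [cocompact_eq_cofinite, Nat.cofinite_eq_atTop] at h

/-- A uniformly bounded, pointwise null sequence of functionals defines an operator into `c₀`. -/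
theorem exists_clm_to_zeroAtInfty (h : ℕ → E →L[𝕜] 𝕜) {M : ℝ} (hM : 0 ≤ M)
    (hb : ∀ k x, ‖h k x‖ ≤ M * ‖x‖) (h0 : ∀ x, Tendsto (fun k => h k x) atTop (𝓝 0)) :
    ∃ S : E →L[𝕜] C₀(ℕ, 𝕜), ‖S‖ ≤ M ∧ ∀ x k, S x k = h k x := by
  let f : E → C₀(ℕ, 𝕜) := fun x =>
    ⟨⟨fun k => h k x, continuous_of_discreteTopology⟩, by
      rw [cocompact_eq_cofinite, Nat.cofinite_eq_atTop]; exact h0 x⟩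
  let L : E →ₗ[𝕜] C₀(ℕ, 𝕜) :=
    { toFun := f
      map_add' := fun x y => by ext k; exact map_add (h k) x y
      map_smul' := fun a x => by ext k; exact map_smul (h k) a x }
  have hL : ∀ x, ‖L x‖ ≤ M * ‖x‖ := fun x =>
    norm_zeroAtInfty_le (by positivity) fun k => hb k x
  exact ⟨L.mkContinuous M hL, L.mkContinuous_norm_le hM hL, fun x k => rfl⟩

/-- A sequence is dominated by the unit vector basis of `c₀`, with constant `M`. -/
def IsC0Bounded (𝕜 : Type*) [RCLike 𝕜] {E : Type*} [NormedAddCommGroup E] [NormedSpace 𝕜 E]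
    (z : ℕ → E) (M : ℝ) : Prop :=
  ∀ (s : Finset ℕ) (c : ℕ → 𝕜), (∀ k ∈ s, ‖c k‖ ≤ 1) → ‖∑ k ∈ s, c k • z k‖ ≤ M

theorem IsC0Bounded.nonneg {z : ℕ → E} {M : ℝ} (hz : IsC0Bounded 𝕜 z M) : 0 ≤ M := by
  simpa using hz ∅ 0 (by simp)

theorem IsC0Bounded.comp {z : ℕ → E} {M : ℝ} (hz : IsC0Bounded 𝕜 z M) {g : ℕ → ℕ}
    (hg : StrictMono g) : IsC0Bounded 𝕜 (fun k => z (g k)) M := by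
  intro s c hc
  have h := hz (s.map ⟨g, hg.injective⟩) (Function.extend g c 0) (by
    intro k hk
    obtain ⟨i, hi, rfl⟩ := Finset.mem_map.1 hk
    simpa [hg.injective.extend_apply] using hc i hi)
  simpa [hg.injective.extend_apply] using h

theorem IsC0Bounded.norm_sum_le {z : ℕ → E} {M : ℝ} (hz : IsC0Bounded 𝕜 z M) (s : Finset ℕ)
    (c : ℕ → 𝕜) {r : ℝ} (hr : 0 < r) (hc : ∀ k ∈ s, ‖c k‖ ≤ r) :
    ‖∑ k ∈ s, c k • z k‖ ≤ M * r := by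
  have h := hz s (fun k => (r : 𝕜)⁻¹ * c k) (by
    intro k hk
    rw [norm_mul, norm_inv, RCLike.norm_ofReal, abs_of_pos hr, inv_mul_le_iff₀ hr, mul_one]
    exact hc k hk)
  simp only [mul_smul, ← Finset.smul_sum] at h
  rw [norm_smul, norm_inv, RCLike.norm_ofReal, abs_of_pos hr, inv_mul_le_iff₀ hr] at h
  linarith

/-- A sequence dominated by the unit vector basis of `c₀` defines an operator on `c₀`. -/
theorem IsC0Bounded.exists_clm [CompleteSpace E] {z : ℕ → E} {M : ℝ} (hz : IsC0Bounded 𝕜 z M) :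
    ∃ R : C₀(ℕ, 𝕜) →L[𝕜] E, ‖R‖ ≤ M ∧ ∀ c, HasSum (fun k => c k • z k) (R c) := by
  have hs : ∀ c : C₀(ℕ, 𝕜), Summable fun k => c k • z k := by
    intro c
    rw [summable_iff_vanishing_norm]
    intro ε hε
    have hM := hz.nonneg
    have hr : 0 < ε / (M + 1) := by positivity
    obtain ⟨N, hN⟩ := Metric.tendsto_atTop.1 (tendsto_zeroAtInfty_atTop c) _ hr
    refine ⟨Finset.range N, fun t ht => ?_⟩
    refine (hz.norm_sum_le t c hr fun k hk => ?_).trans_lt ?_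
    · have hk' : N ≤ k := by
        by_contra hlt
        exact Finset.disjoint_left.1 ht hk (Finset.mem_range.2 (not_le.1 hlt))
      simpa using (hN k hk').le
    · rw [mul_div_assoc', div_lt_iff₀ (by positivity)]
      nlinarith
  let L : C₀(ℕ, 𝕜) →ₗ[𝕜] E :=
    { toFun := fun c => ∑' k, c k • z k
      map_add' := fun c d => by
        rw [← (hs c).tsum_add (hs d)]
        exact tsum_congr fun k => add_smul _ _ _
      map_smul' := fun a c => by
        rw [RingHom.id_apply, ← (hs c).tsum_const_smul a]
        exact tsum_congr fun k => mul_smul _ _ _ }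
  have hL : ∀ c, ‖L c‖ ≤ M * ‖c‖ := by
    intro c
    by_cases hc : c = 0
    · simp [hc]
    refine le_of_tendsto (hs c).hasSum.norm (Eventually.of_forall fun s => ?_)
    exact hz.norm_sum_le s c (norm_pos_iff.2 hc) fun k _ => norm_apply_le_norm_zeroAtInfty c k
  exact ⟨L.mkContinuous M hL, L.mkContinuous_norm_le hz.nonneg hL, fun c => (hs c).hasSum⟩

theorem IsC0Bounded.tendsto_apply {z : ℕ → E} {M : ℝ} (hz : IsC0Bounded 𝕜 z M)
    (g : E →L[𝕜] 𝕜) : Tendsto (fun k => g (z k)) atTop (𝓝 0) := by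
  have hs : Summable fun k => ‖g (z k)‖ := by
    refine summable_of_sum_le (c := ‖g‖ * M) (fun k => norm_nonneg _) fun s => ?_
    let c : ℕ → 𝕜 := fun k => (‖g (z k)‖ : 𝕜)⁻¹ * star (g (z k))
    have hc : ∀ k, ‖c k‖ ≤ 1 := by
      intro k
      simp only [c, norm_mul, norm_inv, RCLike.norm_ofReal, abs_norm, norm_star]
      exact inv_mul_le_one
    have hck : ∀ k, c k * g (z k) = (‖g (z k)‖ : 𝕜) := by
      intro k
      by_cases h : g (z k) = 0
      · simp [h]
      have h' : (‖g (z k)‖ : 𝕜) ≠ 0 := by simpa using h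
      simp only [c, RCLike.star_def, mul_assoc, RCLike.conj_mul]
      field_simp
    have h1 : g (∑ k ∈ s, c k • z k) = ((∑ k ∈ s, ‖g (z k)‖ : ℝ) : 𝕜) := by
      simp [map_sum, hck]
    calc ∑ k ∈ s, ‖g (z k)‖ = ‖g (∑ k ∈ s, c k • z k)‖ := by
          rw [h1, RCLike.norm_ofReal, abs_of_nonneg (Finset.sum_nonneg fun _ _ => norm_nonneg _)]
      _ ≤ ‖g‖ * ‖∑ k ∈ s, c k • z k‖ := g.le_opNorm _
      _ ≤ ‖g‖ * M := by gcongr; exact hz s c fun k _ => hc k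
  exact tendsto_zero_iff_norm_tendsto_zero.2 hs.tendsto_atTop_zero

/-- A matrix with null rows and columns has principal submatrices which are almost diagonal. -/
theorem exists_subseq_almost_diagonal (a : ℕ → ℕ → 𝕜)
    (hrow : ∀ i, Tendsto (a i) atTop (𝓝 0)) (hcol : ∀ j, Tendsto (fun i => a i j) atTop (𝓝 0))
    {ε : ℝ} (hε : 0 < ε) :
    ∃ f : ℕ → ℕ, StrictMono f ∧ ∀ i j, i ≠ j → ‖a (f i) (f j)‖ ≤ ε * (1 / 2) ^ j := by
  obtain ⟨F, -, hF⟩ := exists_seq_of_forall_finset_exists (α := ℕ × ℕ) (fun _ => True)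
    (fun p q => p.1 < q.1 ∧ p.2 < q.2 ∧ ‖a p.2 q.2‖ ≤ ε * (1 / 2) ^ q.1 ∧
      ‖a q.2 p.2‖ ≤ ε * (1 / 2) ^ q.1) (by
    intro s _
    obtain ⟨N, hN⟩ : ∃ N, ∀ p ∈ s, p.1 < N :=
      ⟨s.sup Prod.fst + 1, fun p hp => Nat.lt_succ_of_le (Finset.le_sup (f := Prod.fst) hp)⟩
    have hpos : ‖(0 : 𝕜)‖ < ε * (1 / 2) ^ N := by rw [norm_zero]; positivity
    have h : ∀ᶠ k in atTop, ∀ p ∈ s, p.2 < k ∧ ‖a p.2 k‖ ≤ ε * (1 / 2) ^ N ∧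
        ‖a k p.2‖ ≤ ε * (1 / 2) ^ N := by
      refine (Filter.eventually_all_finset s).2 fun p _ => ?_
      filter_upwards [eventually_gt_atTop p.2,
        (hrow p.2).norm.eventually_le_const hpos,
        (hcol p.2).norm.eventually_le_const hpos] with k h1 h2 h3
      exact ⟨h1, h2, h3⟩
    obtain ⟨k, hk⟩ := h.exists
    exact ⟨(N, k), trivial, fun p hp => ⟨hN p hp, hk p hp⟩⟩)
  have hle : ∀ n, n ≤ (F n).1 := by
    intro n
    exact (strictMono_nat_of_lt_succ fun n => (hF n (n + 1) n.lt_succ_self).1).id_le n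
  have hpow : ∀ {m n : ℕ}, m ≤ n → ε * (1 / 2 : ℝ) ^ n ≤ ε * (1 / 2) ^ m := fun h =>
    mul_le_mul_of_nonneg_left (pow_le_pow_of_le_one (by norm_num) (by norm_num) h) hε.le
  refine ⟨fun n => (F n).2, strictMono_nat_of_lt_succ fun n => (hF n (n + 1) n.lt_succ_self).2.1,
    fun i j hij => ?_⟩
  rcases hij.lt_or_gt with h | h
  · exact (hF i j h).2.2.1.trans (hpow (hle j))
  · exact (hF j i h).2.2.2.trans (hpow (h.le.trans (hle i)))

/-- An operator which does not send a `c₀`-sequence close to zero, as witnessed by a weak* null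
sequence of functionals, fixes a copy of `c₀` with controlled constants. -/
theorem IsC0Bounded.exists_factor_id [CompleteSpace E] {z : ℕ → E} {M : ℝ}
    (hz : IsC0Bounded 𝕜 z M) (T : E →L[𝕜] F) (h : ℕ → F →L[𝕜] 𝕜)
    (hb : ∀ k x, ‖h k x‖ ≤ 2 * ‖x‖) (h0 : ∀ x, Tendsto (fun k => h k x) atTop (𝓝 0))
    {d : ℝ} (hd : 0 < d) (hdiag : ∀ k, d ≤ ‖h k (T (z k))‖) :
    ∃ (R : C₀(ℕ, 𝕜) →L[𝕜] E) (S : F →L[𝕜] C₀(ℕ, 𝕜)), ‖R‖ ≤ M ∧ ‖S‖ ≤ 4 / d ∧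
      S ∘L T ∘L R = ContinuousLinearMap.id 𝕜 C₀(ℕ, 𝕜) := by
  obtain ⟨f, hf, hfε⟩ := exists_subseq_almost_diagonal (fun i j => h i (T (z j)))
    (fun i => hz.tendsto_apply (h i ∘L T)) (fun j => h0 _) (ε := d / 4) (by positivity)
  obtain ⟨R, hR, hRs⟩ := (hz.comp hf).exists_clm
  let D : ℕ → 𝕜 := fun i => h (f i) (T (z (f i)))
  have hD : ∀ i, d ≤ ‖D i‖ := fun i => hdiag (f i)
  have hD0 : ∀ i, D i ≠ 0 := fun i => norm_pos_iff.1 (hd.trans_le (hD i))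
  have hDinv : ∀ i, ‖(D i)⁻¹‖ ≤ d⁻¹ := fun i => by
    rw [norm_inv]; exact inv_anti₀ hd (hD i)
  obtain ⟨S₀, hS₀, hS₀a⟩ := exists_clm_to_zeroAtInfty (fun i => (D i)⁻¹ • h (f i))
    (M := 2 / d) (by positivity)
    (fun i x => by
      rw [smul_apply, norm_smul]
      calc ‖(D i)⁻¹‖ * ‖h (f i) x‖ ≤ d⁻¹ * (2 * ‖x‖) := by
            gcongr
            · exact hDinv i
            · exact hb _ _
        _ = 2 / d * ‖x‖ := by ring)
    (fun x => by
      rw [tendsto_zero_iff_norm_tendsto_zero]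
      refine squeeze_zero (g := fun i => d⁻¹ * ‖h (f i) x‖) (fun _ => norm_nonneg _)
        (fun i => ?_) ?_
      · rw [smul_apply, norm_smul]
        gcongr
        exact hDinv i
      · simpa using (((h0 x).comp hf.tendsto_atTop).norm).const_mul d⁻¹)
  let P : C₀(ℕ, 𝕜) →L[𝕜] C₀(ℕ, 𝕜) := S₀ ∘L T ∘L R
  have hclose : ∀ c, ‖P c - c‖ ≤ 1 / 2 * ‖c‖ := by
    intro c
    refine norm_zeroAtInfty_le (by positivity) fun i => ?_
    have h1 : HasSum (fun j => (D i)⁻¹ * h (f i) (T (z (f j))) * c j) (P c i) := by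
      have h2 := (hRs c).mapL ((D i)⁻¹ • (h (f i) ∘L T))
      have h3 : P c i = ((D i)⁻¹ • (h (f i) ∘L T)) (R c) := hS₀a _ i
      rw [h3]
      convert h2 using 1
      funext j
      simp only [smul_apply, ContinuousLinearMap.comp_apply, map_smul,
        smul_eq_mul]
      ring
    have h4 : HasSum (fun j => (D i)⁻¹ * h (f i) (T (z (f j))) * c j -
        if j = i then c i else 0) (P c i - c i) := h1.sub (hasSum_ite_eq i (c i))
    have hg : HasSum (fun j : ℕ => 1 / 4 * ‖c‖ * (1 / 2 : ℝ) ^ j) (1 / 4 * ‖c‖ * 2) :=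
      hasSum_geometric_two.mul_left _
    refine (h4.norm_le_of_bounded hg fun j => ?_).trans (by linarith)
    by_cases hij : j = i
    · subst hij
      rw [if_pos rfl, show h (f j) (T (z (f j))) = D j from rfl, inv_mul_cancel₀ (hD0 j), one_mul,
        sub_self, norm_zero]
      positivity
    · rw [if_neg hij, sub_zero, norm_mul, norm_mul]
      calc ‖(D i)⁻¹‖ * ‖h (f i) (T (z (f j)))‖ * ‖c j‖
          ≤ d⁻¹ * (d / 4 * (1 / 2) ^ j) * ‖c‖ := by
            gcongr
            · exact hDinv i
            · exact hfε i j (Ne.symm hij)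
            · exact norm_apply_le_norm_zeroAtInfty c j
        _ = 1 / 4 * ‖c‖ * (1 / 2 : ℝ) ^ j := by field_simp
  have hlt : ‖ContinuousLinearMap.id 𝕜 C₀(ℕ, 𝕜) - P‖ < 1 := by
    refine (ContinuousLinearMap.opNorm_le_bound _ (by norm_num : (0 : ℝ) ≤ 1 / 2)
      fun c => ?_).trans_lt (by norm_num)
    rw [sub_apply, ContinuousLinearMap.id_apply, norm_sub_rev]
    exact hclose c
  obtain ⟨G, hGP, hPG⟩ : ∃ G : C₀(ℕ, 𝕜) →L[𝕜] C₀(ℕ, 𝕜),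
      G ∘L P = ContinuousLinearMap.id 𝕜 C₀(ℕ, 𝕜) ∧ P ∘L G = ContinuousLinearMap.id 𝕜 C₀(ℕ, 𝕜) := by
    let u := Units.oneSub (R := C₀(ℕ, 𝕜) →L[𝕜] C₀(ℕ, 𝕜)) (ContinuousLinearMap.id 𝕜 C₀(ℕ, 𝕜) - P) hlt
    have hu : u.val = P := by
      rw [Units.val_oneSub]
      exact sub_sub_cancel (1 : C₀(ℕ, 𝕜) →L[𝕜] C₀(ℕ, 𝕜)) P
    refine ⟨u.inv, ?_, ?_⟩
    · rw [← hu]; exact u.inv_val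
    · rw [← hu]; exact u.val_inv
  have hG : ‖G‖ ≤ 2 := by
    refine ContinuousLinearMap.opNorm_le_bound _ (by norm_num) fun c => ?_
    have h1 : P (G c) = c := DFunLike.congr_fun hPG c
    have h2 := hclose (G c)
    rw [h1, norm_sub_rev] at h2
    have h3 := norm_sub_norm_le (G c) c
    linarith
  refine ⟨R, G ∘L S₀, hR, ?_, hGP⟩
  calc ‖G ∘L S₀‖ ≤ ‖G‖ * ‖S₀‖ := G.opNorm_comp_le S₀
    _ ≤ 2 * (2 / d) := by gcongr
    _ = 4 / d := by ring

end SequenceSpace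

section AutomaticContinuity

variable {𝕜 : Type*} [RCLike 𝕜]

/-- The main boundedness principle behind automatic continuity: a homomorphism cannot be
unbounded along the products of a biorthogonal system. -/
theorem not_forall_lt_norm_map_mul {𝔸 B : Type*} [NormedRing 𝔸] [NormedAlgebra 𝕜 𝔸]
    [CompleteSpace 𝔸] [NonUnitalNormedRing B] [NormedSpace 𝕜 B] (φ : 𝔸 →ₙₐ[𝕜] B)
    (a b : ℕ × ℕ → 𝔸) {M : ℝ} (ha : ∀ p, ‖a p‖ ≤ M) (hb : ∀ p, ‖b p‖ ≤ M)
    (hab : ∀ p q, p ≠ q → a p * b q = 0) :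
    ¬ ∀ p, (4 : ℝ) ^ (p.1 + p.2) < ‖φ (a p * b p)‖ := by
  intro hφ
  have hsum : ∀ x : ℕ → 𝔸, (∀ i, ‖x i‖ ≤ M) → Summable fun i => ((1 / 2 : 𝕜) ^ i) • x i := by
    intro x hx
    refine Summable.of_norm_bounded (g := fun i => (1 / 2 : ℝ) ^ i * M)
      (summable_geometric_two.mul_right M) fun i => ?_
    rw [norm_smul, norm_pow, norm_div, norm_one, RCLike.norm_ofNat]
    gcongr
    exact hx i
  let c : ℕ → 𝔸 := fun i => ∑' j, ((1 / 2 : 𝕜) ^ j) • b (i, j)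
  have hc : ∀ i j, a (i, j) * c i = ((1 / 2 : 𝕜) ^ j) • (a (i, j) * b (i, j)) := by
    intro i j
    rw [← (hsum (fun j => b (i, j)) fun _ => hb _).tsum_mul_left, tsum_eq_single j]
    · rw [mul_smul_comm]
    · intro k hk
      rw [mul_smul_comm, hab _ _ (by simpa using hk.symm), smul_zero]
  have hc' : ∀ i i' j, i ≠ i' → a (i, j) * c i' = 0 := by
    intro i i' j hi
    rw [← (hsum (fun j => b (i', j)) fun _ => hb _).tsum_mul_left]
    simp [hab (i, j) (i', _) (by simp [hi])]
  choose J hJ using fun i => pow_unbounded_of_one_lt ‖φ (c i)‖ (one_lt_two (α := ℝ))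
  let y : 𝔸 := ∑' i, ((1 / 2 : 𝕜) ^ i) • a (i, J i)
  have hy : ∀ i, y * c i = ((1 / 2 : 𝕜) ^ i) • ((1 / 2 : 𝕜) ^ J i) • (a (i, J i) * b (i, J i)) := by
    intro i
    rw [← (hsum (fun i => a (i, J i)) fun _ => ha _).tsum_mul_right, tsum_eq_single i]
    · rw [smul_mul_assoc, hc]
    · intro k hk
      rw [smul_mul_assoc, hc' _ _ _ hk, smul_zero]
  obtain ⟨i, hi⟩ := pow_unbounded_of_one_lt ‖φ y‖ (one_lt_two (α := ℝ))
  have h1 : ‖φ (y * c i)‖ ≤ ‖φ y‖ * ‖φ (c i)‖ := by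
    rw [map_mul]; exact norm_mul_le _ _
  rw [hy, map_smul, map_smul, norm_smul, norm_smul, norm_pow, norm_pow, norm_div, norm_one,
    RCLike.norm_ofNat] at h1
  have h2 := hφ (i, J i)
  have h3 : ‖φ y‖ * ‖φ (c i)‖ ≤ 2 ^ i * 2 ^ J i :=
    mul_le_mul hi.le (hJ i).le (norm_nonneg _) (by positivity)
  have h4 : (1 / 2 : ℝ) ^ i * ((1 / 2) ^ J i * 4 ^ (i + J i)) = 2 ^ i * 2 ^ J i := by
    rw [pow_add, show (4 : ℝ) = 2 * 2 by norm_num, mul_pow, mul_pow, one_div, inv_pow, inv_pow]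
    field_simp
  have h5 : (1 / 2 : ℝ) ^ i * ((1 / 2) ^ J i * 4 ^ (i + J i)) <
      (1 / 2 : ℝ) ^ i * ((1 / 2) ^ J i * ‖φ (a (i, J i) * b (i, J i))‖) := by
    gcongr
  linarith

/-- A Baire category argument: countably many sets covering a Banach space, which are stable under
differences and geometric series, contain a ball. -/
theorem exists_ball_subset_of_iUnion {E : Type*} [NormedAddCommGroup E] [NormedSpace 𝕜 E]
    [CompleteSpace E] (S : ℕ → Set E) (hU : ∀ x, ∃ n, x ∈ S n)
    (hsub : ∀ n, ∃ m, ∀ x ∈ S n, ∀ y ∈ S n, x - y ∈ S m)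
    (hser : ∀ n, ∃ m, ∀ (t : ℕ → E) (x : E), (∀ k, t k ∈ S n) →
      HasSum (fun k => ((1 / 4 : 𝕜) ^ k) • t k) x → x ∈ S m) :
    ∃ r > 0, ∃ n, Metric.ball 0 r ⊆ S n := by
  obtain ⟨n, x₀, hx₀⟩ := nonempty_interior_of_iUnion_of_closed (f := fun n => closure (S n))
    (fun n => isClosed_closure) (Set.eq_univ_of_forall fun x =>
      Set.mem_iUnion.2 ((hU x).imp fun n hn => subset_closure hn))
  obtain ⟨r, hr, hball⟩ := Metric.isOpen_iff.1 isOpen_interior x₀ hx₀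
  obtain ⟨m, hm⟩ := hsub n
  obtain ⟨N, hN⟩ := hser m
  have happ : ∀ x : E, ∃ t, ‖x‖ < r → t ∈ S m ∧ ‖x - t‖ < r / 4 := by
    intro x
    by_cases hx : ‖x‖ < r
    · have h1 : x₀ + x ∈ closure (S n) := interior_subset (hball (by simpa using hx))
      have h2 : x₀ ∈ closure (S n) := interior_subset hx₀
      obtain ⟨s, hs, hs'⟩ := Metric.mem_closure_iff.1 h1 (r / 8) (by positivity)
      obtain ⟨t, ht, ht'⟩ := Metric.mem_closure_iff.1 h2 (r / 8) (by positivity)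
      refine ⟨s - t, fun _ => ⟨hm s hs t ht, ?_⟩⟩
      rw [dist_eq_norm] at hs' ht'
      calc ‖x - (s - t)‖ = ‖(x₀ + x - s) - (x₀ - t)‖ := by congr 1; abel
        _ ≤ ‖x₀ + x - s‖ + ‖x₀ - t‖ := norm_sub_le _ _
        _ < r / 4 := by linarith
    · exact ⟨0, fun h => absurd h hx⟩
  choose t ht using happ
  refine ⟨r, hr, N, fun x hx => ?_⟩
  let w : ℕ → E := fun k => Nat.rec x (fun _ v => (4 : 𝕜) • (v - t v)) k
  have hw0 : w 0 = x := rfl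
  have hws : ∀ k, w (k + 1) = (4 : 𝕜) • (w k - t (w k)) := fun k => rfl
  have hw : ∀ k, ‖w k‖ < r := by
    intro k
    induction k with
    | zero => simpa [hw0] using hx
    | succ k ih =>
      rw [hws, norm_smul, RCLike.norm_ofNat]
      linarith [(ht (w k) ih).2]
  have hrem : ∀ k, ∑ i ∈ Finset.range k, ((1 / 4 : 𝕜) ^ i) • t (w i) =
      x - ((1 / 4 : 𝕜) ^ k) • w k := by
    intro k
    induction k with
    | zero => simp [hw0]
    | succ k ih =>
      rw [Finset.sum_range_succ, ih, hws, smul_smul, pow_succ, mul_assoc, one_div,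
        inv_mul_cancel₀ (by norm_num : (4 : 𝕜) ≠ 0), mul_one, smul_sub]
      abel
  refine hN (fun k => t (w k)) x (fun k => (ht (w k) (hw k)).1) ?_
  have hbd : ∀ k, ‖t (w k)‖ ≤ 2 * r := by
    intro k
    have h1 := norm_sub_norm_le (t (w k)) (w k)
    rw [norm_sub_rev] at h1
    linarith [(ht (w k) (hw k)).2, hw k]
  have hsm : Summable fun k => ((1 / 4 : 𝕜) ^ k) • t (w k) := by
    refine Summable.of_norm_bounded (g := fun i => (1 / 4 : ℝ) ^ i * (2 * r))
      ((summable_geometric_of_lt_one (by norm_num) (by norm_num)).mul_right _) fun i => ?_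
    rw [norm_smul, norm_pow, norm_div, norm_one, RCLike.norm_ofNat]
    gcongr
    exact hbd i
  rw [hsm.hasSum_iff_tendsto_nat]
  simp only [hrem]
  have h0 : Tendsto (fun k => ((1 / 4 : 𝕜) ^ k) • w k) atTop (𝓝 0) := by
    rw [tendsto_zero_iff_norm_tendsto_zero]
    refine squeeze_zero (g := fun k => (1 / 4 : ℝ) ^ k * r) (fun _ => norm_nonneg _)
      (fun k => ?_) ?_
    · rw [norm_smul, norm_pow, norm_div, norm_one, RCLike.norm_ofNat]
      gcongr
      exact (hw k).le
    · simpa using (tendsto_pow_atTop_nhds_zero_of_lt_one (by norm_num : (0 : ℝ) ≤ 1 / 4)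
        (by norm_num)).mul_const r
  simpa using tendsto_const_nhds.sub h0

/-- The space `c₀` is the `c₀`-sum of countably many copies of itself. -/
theorem exists_biorthogonal_zeroAtInfty (𝕜 : Type*) [RCLike 𝕜] :
    ∃ Q J : ℕ → C₀(ℕ, 𝕜) →L[𝕜] C₀(ℕ, 𝕜), (∀ k, ‖Q k‖ ≤ 1) ∧ (∀ k, ‖J k‖ ≤ 1) ∧
      (∀ k, Q k ∘L J k = ContinuousLinearMap.id 𝕜 C₀(ℕ, 𝕜)) ∧
      ∀ k l, k ≠ l → Q k ∘L J l = 0 := by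
  have hev : ∀ n, ∃ e : C₀(ℕ, 𝕜) →L[𝕜] 𝕜, ∀ c, e c = c n := fun n =>
    ⟨LinearMap.mkContinuous
      { toFun := fun c : C₀(ℕ, 𝕜) => c n, map_add' := fun _ _ => rfl, map_smul' := fun _ _ => rfl }
      1 fun c => by simpa using norm_apply_le_norm_zeroAtInfty c n, fun _ => rfl⟩
  choose e he using hev
  have hQ : ∀ k, ∃ Q : C₀(ℕ, 𝕜) →L[𝕜] C₀(ℕ, 𝕜), ‖Q‖ ≤ 1 ∧ ∀ c m, Q c m = c (Nat.pair k m) := by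
    intro k
    obtain ⟨Q, hQ, hQ'⟩ := exists_clm_to_zeroAtInfty (fun m => e (Nat.pair k m)) zero_le_one
      (fun m c => by
        rw [he, one_mul]; exact norm_apply_le_norm_zeroAtInfty c _)
      (fun c => by
        simp only [he]
        exact (tendsto_zeroAtInfty_atTop c).comp
          (tendsto_atTop_mono (fun m => Nat.right_le_pair k m) tendsto_id))
    exact ⟨Q, hQ, fun c m => by rw [hQ', he]⟩
  have hJ : ∀ k, ∃ J : C₀(ℕ, 𝕜) →L[𝕜] C₀(ℕ, 𝕜), ‖J‖ ≤ 1 ∧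
      ∀ c l m, J c (Nat.pair l m) = if l = k then c m else 0 := by
    intro k
    obtain ⟨J, hJ, hJ'⟩ := exists_clm_to_zeroAtInfty
      (fun n => if n.unpair.1 = k then e n.unpair.2 else 0) zero_le_one
      (fun n c => by
        split_ifs
        · rw [he, one_mul]; exact norm_apply_le_norm_zeroAtInfty c _
        · simp)
      (fun c => by
        rw [Metric.tendsto_atTop]
        intro ε hε
        obtain ⟨N, hN⟩ := Metric.tendsto_atTop.1 (tendsto_zeroAtInfty_atTop c) ε hε
        obtain ⟨K, hK⟩ := ((Finset.range N).image (Nat.pair k)).bddAbove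
        refine ⟨K + 1, fun n hn => ?_⟩
        split_ifs with h
        · rw [he]
          refine hN _ (not_lt.1 fun hlt => ?_)
          have h1 : n ≤ K := hK (by
            rw [Finset.mem_coe, Finset.mem_image]
            exact ⟨n.unpair.2, Finset.mem_range.2 hlt, by rw [← h, Nat.pair_unpair]⟩)
          omega
        · simpa using hε)
    refine ⟨J, hJ, fun c l m => ?_⟩
    rw [hJ', Nat.unpair_pair]
    dsimp only
    split_ifs <;> simp [he]
  choose Q hQ hQa using hQ
  choose J hJ hJa using hJ
  refine ⟨Q, J, hQ, hJ, fun k => ?_, fun k l hkl => ?_⟩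
  · ext c m
    simp [hQa, hJa]
  · ext c m
    simp [hQa, hJa, hkl]

end AutomaticContinuity

section FewOperators

variable {𝕜 : Type*} [RCLike 𝕜] {E : Type*} [NormedAddCommGroup E] [NormedSpace 𝕜 E]
  {B : Type*} [NonUnitalNormedRing B] [NormedSpace 𝕜 B]

theorem exists_hasSum_pow_smul {G : Type*} [NormedAddCommGroup G] [NormedSpace 𝕜 G]
    [CompleteSpace G] {a : 𝕜} {g : ℕ → G} {n : ℕ} (ha : ‖a‖ ≤ 1 / 2) (hg : ∀ k, ‖g k‖ ≤ n) :
    ∃ y, HasSum (fun k => a ^ k • g k) y ∧ ‖y‖ ≤ ((2 * n : ℕ) : ℝ) := by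
  have hgeo : HasSum (fun k : ℕ => (1 / 2 : ℝ) ^ k * n) (2 * n) := hasSum_geometric_two.mul_right _
  have hb : ∀ k, ‖a ^ k • g k‖ ≤ (1 / 2 : ℝ) ^ k * n := by
    intro k
    rw [norm_smul, norm_pow]
    gcongr
    exact hg k
  have hs : Summable fun k => a ^ k • g k := Summable.of_norm_bounded hgeo.summable hb
  refine ⟨_, hs.hasSum, ?_⟩
  push_cast
  exact hs.hasSum.norm_le_of_bounded hgeo hb

theorem exists_norm_map_comp_le [CompleteSpace E] (φ : (E →L[𝕜] E) →ₙₐ[𝕜] B) {α : C₀(ℕ, 𝕜) →L[𝕜] E}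
    {β : E →L[𝕜] C₀(ℕ, 𝕜)} (hβα : β ∘L α = ContinuousLinearMap.id 𝕜 C₀(ℕ, 𝕜)) :
    ∃ C : ℝ, 0 ≤ C ∧ ∀ (U : C₀(ℕ, 𝕜) →L[𝕜] E) (V : E →L[𝕜] C₀(ℕ, 𝕜)), ‖U‖ ≤ 1 → ‖V‖ ≤ 1 →
      ‖φ (U ∘L V)‖ ≤ C := by
  by_contra! hcon
  obtain ⟨Q, J, hQ, hJ, hQJ, hQJ'⟩ := exists_biorthogonal_zeroAtInfty 𝕜
  choose U V hU hV hUV using fun p : ℕ × ℕ => hcon ((4 : ℝ) ^ (p.1 + p.2)) (by positivity)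
  let k : ℕ × ℕ → ℕ := fun p => Nat.pair p.1 p.2
  have hk : ∀ p q, p ≠ q → k p ≠ k q := fun p q hpq h => hpq (Prod.ext_iff.2 (Nat.pair_eq_pair.1 h))
  have hmul : ∀ p q, (U p ∘L Q (k p) ∘L β) * (α ∘L J (k q) ∘L V q) =
      U p ∘L (Q (k p) ∘L J (k q)) ∘L V q := by
    intro p q
    ext x
    have h := DFunLike.congr_fun hβα (J (k q) (V q x))
    simp only [ContinuousLinearMap.comp_apply, ContinuousLinearMap.id_apply] at h
    simp [h]
  refine not_forall_lt_norm_map_mul φ (fun p => U p ∘L Q (k p) ∘L β) (fun p => α ∘L J (k p) ∘L V p)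
    (M := max ‖β‖ ‖α‖) (fun p => ?_) (fun p => ?_) (fun p q hpq => ?_) (fun p => ?_)
  · calc ‖U p ∘L Q (k p) ∘L β‖ ≤ ‖U p‖ * (‖Q (k p)‖ * ‖β‖) :=
          ((U p).opNorm_comp_le _).trans (by gcongr; exact (Q _).opNorm_comp_le _)
      _ ≤ 1 * (1 * ‖β‖) := by gcongr; exacts [hU p, hQ _]
      _ ≤ max ‖β‖ ‖α‖ := by simp
  · calc ‖α ∘L J (k p) ∘L V p‖ ≤ ‖α‖ * (‖J (k p)‖ * ‖V p‖) :=
          (α.opNorm_comp_le _).trans (by gcongr; exact (J _).opNorm_comp_le _)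
      _ ≤ ‖α‖ * (1 * 1) := by gcongr; exacts [hJ _, hV p]
      _ ≤ max ‖β‖ ‖α‖ := by simp
  · rw [hmul, hQJ' _ _ (hk p q hpq)]
    simp
  · rw [hmul, hQJ, ContinuousLinearMap.id_comp]
    exact hUV p

theorem continuous_of_few_operators [CompleteSpace E] (φ : (E →L[𝕜] E) →ₙₐ[𝕜] B)
    (h_few : ∀ T : E →L[𝕜] E, ∃ (c : 𝕜) (V : E →L[𝕜] C₀(ℕ, 𝕜)) (U : C₀(ℕ, 𝕜) →L[𝕜] E),
      T = c • ContinuousLinearMap.id 𝕜 E + U ∘L V)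
    {α : C₀(ℕ, 𝕜) →L[𝕜] E} {β : E →L[𝕜] C₀(ℕ, 𝕜)}
    (hβα : β ∘L α = ContinuousLinearMap.id 𝕜 C₀(ℕ, 𝕜)) :
    ∃ C : ℝ, ∀ T, ‖φ T‖ ≤ C * ‖T‖ := by
  obtain ⟨Q, J, hQ, hJ, hQJ, hQJ'⟩ := exists_biorthogonal_zeroAtInfty 𝕜
  obtain ⟨C, hC, hφ⟩ := exists_norm_map_comp_le φ hβα
  let S : ℕ → Set (E →L[𝕜] E) := fun n => {T | ∃ (c : 𝕜) (V : E →L[𝕜] C₀(ℕ, 𝕜))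
    (U : C₀(ℕ, 𝕜) →L[𝕜] E), ‖c‖ ≤ n ∧ ‖V‖ ≤ n ∧ ‖U‖ ≤ n ∧
      T = c • ContinuousLinearMap.id 𝕜 E + U ∘L V}
  obtain ⟨r, hr, n, hn⟩ := exists_ball_subset_of_iUnion (𝕜 := 𝕜) S
    (fun T => by
      obtain ⟨c, V, U, hT⟩ := h_few T
      obtain ⟨n, hn⟩ := exists_nat_ge (max ‖c‖ (max ‖V‖ ‖U‖))
      simp only [max_le_iff] at hn
      exact ⟨n, c, V, U, hn.1, hn.2.1, hn.2.2, hT⟩)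
    (fun n => by
      refine ⟨2 * n, ?_⟩
      rintro _ ⟨c, V, U, hc, hV, hU, rfl⟩ _ ⟨c', V', U', hc', hV', hU', rfl⟩
      have key : ∀ {x y : ℝ}, x ≤ n → y ≤ n → x + y ≤ ((2 * n : ℕ) : ℝ) := by
        intro x y hx hy; push_cast; linarith
      have hJV : ∀ k (W : E →L[𝕜] C₀(ℕ, 𝕜)), ‖J k ∘L W‖ ≤ ‖W‖ := fun k W =>
        ((J k).opNorm_comp_le W).trans (mul_le_of_le_one_left (norm_nonneg _) (hJ k))
      have hUQ : ∀ k (W : C₀(ℕ, 𝕜) →L[𝕜] E), ‖W ∘L Q k‖ ≤ ‖W‖ := fun k W =>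
        (W.opNorm_comp_le (Q k)).trans (mul_le_of_le_one_right (norm_nonneg _) (hQ k))
      refine ⟨c - c', J 0 ∘L V - J 1 ∘L V', U ∘L Q 0 + U' ∘L Q 1,
        (norm_sub_le _ _).trans (key hc hc'),
        (norm_sub_le (J 0 ∘L V) (J 1 ∘L V')).trans
          (key ((hJV _ _).trans hV) ((hJV _ _).trans hV')),
        (norm_add_le (U ∘L Q 0) (U' ∘L Q 1)).trans
          (key ((hUQ _ _).trans hU) ((hUQ _ _).trans hU')), ?_⟩
      ext x : 1
      have e1 := DFunLike.congr_fun (hQJ 0) (V x)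
      have e2 := DFunLike.congr_fun (hQJ 1) (V' x)
      have e3 := DFunLike.congr_fun (hQJ' 0 1 zero_ne_one) (V' x)
      have e4 := DFunLike.congr_fun (hQJ' 1 0 one_ne_zero) (V x)
      simp only [ContinuousLinearMap.comp_apply, ContinuousLinearMap.id_apply, zero_apply]
        at e1 e2 e3 e4
      simp only [add_apply, sub_apply, smul_apply,
        ContinuousLinearMap.comp_apply, ContinuousLinearMap.id_apply, map_sub, e1, e2, e3, e4,
        sub_smul, map_zero]
      abel)
    (fun n => by
      refine ⟨2 * n, fun t x ht hx => ?_⟩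
      choose c V U hc hV hU hT using ht
      have h4 : ‖(1 / 4 : 𝕜)‖ ≤ 1 / 2 := by
        rw [norm_div, norm_one, RCLike.norm_ofNat]; norm_num
      have h2 : ‖(1 / 2 : 𝕜)‖ ≤ 1 / 2 := by
        rw [norm_div, norm_one, RCLike.norm_ofNat]
      obtain ⟨c', hc's, hc'⟩ := exists_hasSum_pow_smul h4 hc
      obtain ⟨V', hVs, hV'⟩ := exists_hasSum_pow_smul (g := fun k => J k ∘L V k) h2 fun k =>
        ((J k).opNorm_comp_le _).trans
          ((mul_le_of_le_one_left (norm_nonneg _) (hJ k)).trans (hV k))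
      obtain ⟨U', hUs, hU'⟩ := exists_hasSum_pow_smul (g := fun k => U k ∘L Q k) h2 fun k =>
        ((U k).opNorm_comp_le _).trans
          ((mul_le_of_le_one_right (norm_nonneg _) (hQ k)).trans (hU k))
      refine ⟨c', V', U', hc', hV', hU', ?_⟩
      have hQV : ∀ k, Q k ∘L V' = (1 / 2 : 𝕜) ^ k • V k := by
        intro k
        have h := (hVs.mapL (ContinuousLinearMap.compL 𝕜 E C₀(ℕ, 𝕜) C₀(ℕ, 𝕜) (Q k)))
        have h' := hasSum_single (f := fun i =>
          ContinuousLinearMap.compL 𝕜 E C₀(ℕ, 𝕜) C₀(ℕ, 𝕜) (Q k)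
          ((1 / 2 : 𝕜) ^ i • (J i ∘L V i))) k (fun i hi => by
            ext x : 1
            have hx := DFunLike.congr_fun (hQJ' k i hi.symm) (V i x)
            simp only [ContinuousLinearMap.comp_apply, zero_apply] at hx
            simp only [ContinuousLinearMap.compL_apply, ContinuousLinearMap.comp_apply, smul_apply,
              map_smul, hx, smul_zero, zero_apply])
        have h'' := h.unique h'
        rwa [ContinuousLinearMap.compL_apply, map_smul, ContinuousLinearMap.compL_apply,
          ← ContinuousLinearMap.comp_assoc, hQJ, ContinuousLinearMap.id_comp] at h''
      refine hx.unique ?_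
      have h1 := hc's.smul_const (ContinuousLinearMap.id 𝕜 E)
      have h3 := hUs.mapL ((ContinuousLinearMap.compL 𝕜 E C₀(ℕ, 𝕜) E).flip V')
      have hsum : (fun k => ((1 / 4 : 𝕜) ^ k) • t k) = fun k =>
          (((1 / 4 : 𝕜) ^ k • c k) • ContinuousLinearMap.id 𝕜 E) +
            (ContinuousLinearMap.compL 𝕜 E C₀(ℕ, 𝕜) E).flip V'
              ((1 / 2 : 𝕜) ^ k • (U k ∘L Q k)) := by
        funext k
        ext x
        have hx := DFunLike.congr_fun (hQV k) x
        simp only [ContinuousLinearMap.comp_apply, smul_apply] at hx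
        rw [hT]
        simp only [ContinuousLinearMap.flip_apply, ContinuousLinearMap.compL_apply, add_apply,
          ContinuousLinearMap.comp_apply, smul_apply, ContinuousLinearMap.id_apply, hx, map_smul,
          smul_add, smul_smul, smul_eq_mul, ← mul_pow]
        norm_num
      rw [hsum]
      exact h1.add h3)
  refine LinearMap.bound_of_ball_bound hr
    (n * ‖φ (ContinuousLinearMap.id 𝕜 E)‖ + (n + 1) * ((n + 1) * C)) (φ : (E →L[𝕜] E) →ₗ[𝕜] B)
    fun T hT => ?_
  obtain ⟨c, V, U, hc, hV, hU, rfl⟩ := hn hT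
  have hn0 : ((n : 𝕜) + 1) ≠ 0 := by exact_mod_cast n.succ_ne_zero
  have hnn : ‖((n : 𝕜) + 1)‖ = n + 1 := by
    have : ((n : 𝕜) + 1) = (((n : ℝ) + 1 : ℝ) : 𝕜) := by push_cast; rfl
    rw [this, RCLike.norm_ofReal, abs_of_nonneg (by positivity)]
  have hle : ∀ {G : Type _} [NormedAddCommGroup G] [NormedSpace 𝕜 G] (g : G), ‖g‖ ≤ n →
      ‖((n : 𝕜) + 1)⁻¹ • g‖ ≤ 1 := by
    intro G _ _ g hg
    rw [norm_smul, norm_inv, hnn, inv_mul_le_iff₀ (by positivity)]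
    linarith
  have hUV : U ∘L V = ((n : 𝕜) + 1) • ((n : 𝕜) + 1) •
      (((n : 𝕜) + 1)⁻¹ • U) ∘L (((n : 𝕜) + 1)⁻¹ • V) := by
    ext x
    simp [smul_smul, hn0]
  change ‖φ (c • ContinuousLinearMap.id 𝕜 E + U ∘L V)‖ ≤ _
  rw [map_add, map_smul]
  refine (norm_add_le _ _).trans (add_le_add ?_ ?_)
  · rw [norm_smul]
    gcongr
  · rw [hUV, map_smul, map_smul, norm_smul, norm_smul, hnn]
    gcongr
    exact hφ _ _ (hle U hU) (hle V hV)

/-- A homomorphism which is open onto its range in a quantitative sense has closed range. -/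
theorem isClosed_range_of_controlled [CompleteSpace E] (φ : (E →L[𝕜] E) →ₙₐ[𝕜] B) {C C' : ℝ}
    (hC : ∀ T, ‖φ T‖ ≤ C * ‖T‖) (hC' : ∀ T, ∃ T', φ T' = φ T ∧ ‖T'‖ ≤ C' * ‖φ T‖) :
    IsClosed (Set.range φ) := by
  let f : NormedAddGroupHom (E →L[𝕜] E) B :=
    { toFun := φ, map_add' := map_add φ, bound' := ⟨C, hC⟩ }
  have hf : f.SurjectiveOnWith f.range (max C' 1) := by
    rintro _ ⟨T, rfl⟩
    obtain ⟨T', h1, h2⟩ := hC' T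
    exact ⟨T', h1, h2.trans (by gcongr; exacts [le_max_left _ _, le_rfl])⟩
  have h := controlled_closure_of_complete (by positivity) one_pos hf
  refine isClosed_of_closure_subset fun y hy => ?_
  obtain ⟨T, hT, -⟩ := h y hy
  exact ⟨T, hT⟩

/-- A bounded homomorphism which does not vanish on all rank-one operators is bounded below. -/
theorem exists_norm_le_of_map_rankOne_ne_zero (φ : (E →L[𝕜] E) →ₙₐ[𝕜] B) {C : ℝ} (hC0 : 0 ≤ C)
    (hC : ∀ T, ‖φ T‖ ≤ C * ‖T‖) {f : E →L[𝕜] 𝕜} {y : E} (hfy : φ (f.smulRight y) ≠ 0) :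
    ∃ C', ∀ T, ‖T‖ ≤ C' * ‖φ T‖ := by
  have hpos : 0 < ‖φ (f.smulRight y)‖ := norm_pos_iff.2 hfy
  refine ⟨2 * (C * ‖y‖ * (C * ‖f‖)) / ‖φ (f.smulRight y)‖, fun T => ?_⟩
  by_cases hT : T = 0
  · rw [hT, norm_zero]; positivity
  obtain ⟨x, hx, hTx⟩ := T.exists_lt_apply_of_lt_opNorm (half_lt_self (norm_pos_iff.2 hT))
  obtain ⟨g, hg, hgx⟩ := exists_dual_vector'' 𝕜 (T x)
  have hmul : (g.smulRight y) * T * (f.smulRight x) = (‖T x‖ : 𝕜) • f.smulRight y := by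
    ext v
    simp [hgx, smul_smul, mul_comm]
  have hr : ∀ (l : E →L[𝕜] 𝕜) (v : E), ‖φ (l.smulRight v)‖ ≤ C * (‖l‖ * ‖v‖) := fun l v => by
    simpa [ContinuousLinearMap.norm_smulRight_apply] using hC (l.smulRight v)
  have h1 : ‖T x‖ * ‖φ (f.smulRight y)‖ ≤ C * ‖y‖ * ‖φ T‖ * (C * ‖f‖) := by
    calc ‖T x‖ * ‖φ (f.smulRight y)‖ = ‖φ ((g.smulRight y) * T * (f.smulRight x))‖ := by
          rw [hmul, map_smul, norm_smul, RCLike.norm_ofReal, abs_norm]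
      _ ≤ ‖φ (g.smulRight y)‖ * ‖φ T‖ * ‖φ (f.smulRight x)‖ := by
          rw [map_mul, map_mul]
          exact (norm_mul_le _ _).trans (by gcongr; exact norm_mul_le _ _)
      _ ≤ (C * (1 * ‖y‖)) * ‖φ T‖ * (C * (‖f‖ * 1)) := by
          gcongr
          · exact (hr _ _).trans (by gcongr)
          · exact (hr _ _).trans (by gcongr)
      _ = _ := by ring
  rw [div_mul_eq_mul_div, le_div_iff₀ hpos]
  nlinarith

end FewOperators

section LimitFunctionals

variable {𝕜 : Type*} [RCLike 𝕜] {𝒜 : Set (Set ℕ)}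

instance XA.completeSpace : CompleteSpace ↥(XA 𝕜 𝒜) :=
  (Submodule.isClosed_topologicalClosure _).completeSpace_coe

/-- Evaluation at `n`, as a functional on `X_𝒜`. -/
noncomputable def evalXA (𝕜 : Type*) [RCLike 𝕜] (𝒜 : Set (Set ℕ)) (n : ℕ) :
    ↥(XA 𝕜 𝒜) →L[𝕜] 𝕜 :=
  lp.evalCLM 𝕜 (fun _ : ℕ => 𝕜) ∞ n ∘L (XA 𝕜 𝒜).subtypeL

theorem evalXA_mk {y : lp (fun _ : ℕ => 𝕜) ∞} (hy : y ∈ XA 𝕜 𝒜) (n : ℕ) :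
    evalXA 𝕜 𝒜 n ⟨y, hy⟩ = y n := rfl

theorem norm_evalXA_le (n : ℕ) (x : ↥(XA 𝕜 𝒜)) : ‖evalXA 𝕜 𝒜 n x‖ ≤ ‖x‖ :=
  lp.norm_apply_le_norm ENNReal.top_ne_zero (x : lp (fun _ : ℕ => 𝕜) ∞) n

theorem norm_XA_le {x : ↥(XA 𝕜 𝒜)} {M : ℝ} (hM : 0 ≤ M) (h : ∀ n, ‖evalXA 𝕜 𝒜 n x‖ ≤ M) :
    ‖x‖ ≤ M :=
  lp.norm_le_of_forall_le hM h

theorem XA_ext {x y : ↥(XA 𝕜 𝒜)} (h : ∀ n, evalXA 𝕜 𝒜 n x = evalXA 𝕜 𝒜 n y) : x = y :=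
  Subtype.ext (lp.ext (funext h))

theorem indLinf_apply (A : Set ℕ) (n : ℕ) [Decidable (n ∈ A)] :
    (indLinf 𝕜 A : lp (fun _ : ℕ => 𝕜) ∞) n = if n ∈ A then 1 else 0 := by
  by_cases h : n ∈ A <;> simp [indLinf, h]

theorem indLinf_mem_XA {A : Set ℕ} (hA : A ∈ 𝒜) : indLinf 𝕜 A ∈ XA 𝕜 𝒜 :=
  Submodule.le_topologicalClosure _ (Submodule.subset_span (Or.inl ⟨A, hA, rfl⟩))

theorem indLinf_singleton_mem_XA (n : ℕ) : indLinf 𝕜 {n} ∈ XA 𝕜 𝒜 :=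
  Submodule.le_topologicalClosure _ (Submodule.subset_span (Or.inr ⟨n, rfl⟩))

open Classical in
theorem indLinf_diff_mem_XA {A : Set ℕ} (hA : A ∈ 𝒜) (F : Finset ℕ) :
    indLinf 𝕜 (A \ F) ∈ XA 𝕜 𝒜 := by
  have h : indLinf 𝕜 (A \ F) = indLinf 𝕜 A - ∑ m ∈ F with m ∈ A, indLinf 𝕜 {m} := by
    ext n
    rw [lp.coeFn_sub, Pi.sub_apply, lp.coeFn_sum, Finset.sum_apply]
    simp only [indLinf_apply, Set.mem_singleton_iff, Finset.sum_ite_eq, Finset.mem_filter,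
      Set.mem_sdiff, Finset.mem_coe]
    by_cases h1 : n ∈ A <;> by_cases h2 : n ∈ F <;> simp [h1, h2]
  rw [h]
  exact sub_mem (indLinf_mem_XA hA) (sum_mem fun m _ => indLinf_singleton_mem_XA m)

/-- A closed subspace of `X_𝒜` containing the generators is everything. -/
theorem mem_of_generators (W : Submodule 𝕜 ↥(XA 𝕜 𝒜)) (hW : IsClosed (W : Set ↥(XA 𝕜 𝒜)))
    (hA : ∀ (A) (h : A ∈ 𝒜), (⟨indLinf 𝕜 A, indLinf_mem_XA h⟩ : ↥(XA 𝕜 𝒜)) ∈ W)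
    (hn : ∀ n, (⟨indLinf 𝕜 {n}, indLinf_singleton_mem_XA n⟩ : ↥(XA 𝕜 𝒜)) ∈ W)
    (x : ↥(XA 𝕜 𝒜)) : x ∈ W := by
  have hcl : IsClosed (W.map (XA 𝕜 𝒜).subtype : Set (lp (fun _ : ℕ => 𝕜) ∞)) :=
    (Submodule.isClosed_topologicalClosure _).isClosedEmbedding_subtypeVal.isClosedMap _ hW
  have hle : XA 𝕜 𝒜 ≤ W.map (XA 𝕜 𝒜).subtype := by
    refine Submodule.topologicalClosure_minimal _ (Submodule.span_le.2 ?_) hcl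
    rintro _ (⟨A, h, rfl⟩ | ⟨n, rfl⟩)
    · exact ⟨_, hA A h, rfl⟩
    · exact ⟨_, hn n, rfl⟩
  obtain ⟨y, hy, hyx⟩ := hle x.2
  rwa [← Subtype.ext hyx]

/-- A uniformly bounded family of operators on `X_𝒜` which tends to zero on the generators tends
to zero pointwise. -/
theorem tendsto_zero_of_generators {ι F : Type*} [NormedAddCommGroup F] [NormedSpace 𝕜 F]
    (g : ι → ↥(XA 𝕜 𝒜) →L[𝕜] F) {l : Filter ι} {M : ℝ} (hM : ∀ i x, ‖g i x‖ ≤ M * ‖x‖)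
    (hA : ∀ (A) (h : A ∈ 𝒜), Tendsto (fun i => g i ⟨indLinf 𝕜 A, indLinf_mem_XA h⟩) l (𝓝 0))
    (hn : ∀ n, Tendsto (fun i => g i ⟨indLinf 𝕜 {n}, indLinf_singleton_mem_XA n⟩) l (𝓝 0))
    (x : ↥(XA 𝕜 𝒜)) : Tendsto (fun i => g i x) l (𝓝 0) := by
  let W : Submodule 𝕜 ↥(XA 𝕜 𝒜) :=
    { carrier := {x | Tendsto (fun i => g i x) l (𝓝 0)}
      zero_mem' := by simp [tendsto_const_nhds]
      add_mem' := fun {x y} hx hy => by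
        simpa using Tendsto.add (Set.mem_ofPred.1 hx) (Set.mem_ofPred.1 hy)
      smul_mem' := fun a x hx => by simpa using Tendsto.const_smul (Set.mem_ofPred.1 hx) a }
  refine mem_of_generators W (isClosed_of_closure_subset fun x hx => ?_) hA hn x
  refine Metric.tendsto_nhds.2 fun ε hε => ?_
  obtain ⟨y, hy, hxy⟩ := Metric.mem_closure_iff.1 hx (ε / (2 * (|M| + 1))) (by positivity)
  filter_upwards [Metric.tendsto_nhds.1 (show Tendsto (fun i => g i y) l (𝓝 0) from hy) (ε / 2)
    (by positivity)] with i hi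
  rw [dist_zero_right] at hi ⊢
  rw [dist_eq_norm, lt_div_iff₀ (by positivity)] at hxy
  have h1 : g i x = g i (x - y) + g i y := by rw [map_sub, sub_add_cancel]
  have h2 := hM i (x - y)
  have h3 : M * ‖x - y‖ ≤ (|M| + 1) * ‖x - y‖ := by
    gcongr; linarith [le_abs_self M]
  have h4 := norm_add_le (g i (x - y)) (g i y)
  rw [h1]
  linarith

/-- The limit along `A`, as a functional on `X_𝒜`. -/
theorem exists_limit_functional (h_ad : ∀ A ∈ 𝒜, ∀ A' ∈ 𝒜, A ≠ A' → (A ∩ A').Finite)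
    {A : Set ℕ} (hA : A ∈ 𝒜) (h_inf : A.Infinite) :
    ∃ l : ↥(XA 𝕜 𝒜) →L[𝕜] 𝕜, (∀ x, ‖l x‖ ≤ ‖x‖) ∧
      ∀ x, Tendsto (fun n => evalXA 𝕜 𝒜 n x) (cofinite ⊓ 𝓟 A) (𝓝 (l x)) := by
  classical
  have : (cofinite ⊓ 𝓟 A).NeBot := cofinite_inf_principal_neBot_iff.2 h_inf
  let u : Ultrafilter ℕ := Ultrafilter.of (cofinite ⊓ 𝓟 A)
  have hu : (u : Filter ℕ) ≤ cofinite ⊓ 𝓟 A := Ultrafilter.of_le _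
  have hlim : ∀ x, ∃ a, ‖a‖ ≤ ‖x‖ ∧ Tendsto (fun n => evalXA 𝕜 𝒜 n x) u (𝓝 a) := by
    intro x
    obtain ⟨a, ha, h⟩ := (isCompact_closedBall (0 : 𝕜) ‖x‖).ultrafilter_le_nhds
      (u.map fun n => evalXA 𝕜 𝒜 n x) (by
        rw [le_principal_iff]
        change ∀ᶠ n in (u : Filter ℕ), evalXA 𝕜 𝒜 n x ∈ Metric.closedBall 0 ‖x‖
        exact Eventually.of_forall fun n => by simpa using norm_evalXA_le n x)
    exact ⟨a, by simpa using ha, h⟩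
  choose L hL hLt using hlim
  let l₀ : ↥(XA 𝕜 𝒜) →ₗ[𝕜] 𝕜 :=
    { toFun := L
      map_add' := fun x y => tendsto_nhds_unique (hLt (x + y)) (by
        simpa using (hLt x).add (hLt y))
      map_smul' := fun a x => tendsto_nhds_unique (hLt (a • x)) (by
        simpa using (hLt x).const_smul a) }
  let l : ↥(XA 𝕜 𝒜) →L[𝕜] 𝕜 := l₀.mkContinuous 1 fun x => by simpa [l₀] using hL x
  have hlL : ∀ x, l x = L x := fun x => rfl
  have hev : ∀ (x : ↥(XA 𝕜 𝒜)) (c : 𝕜), (∀ᶠ n in cofinite ⊓ 𝓟 A, evalXA 𝕜 𝒜 n x = c) →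
      Tendsto (fun n => (evalXA 𝕜 𝒜 n - l) x) (cofinite ⊓ 𝓟 A) (𝓝 0) := by
    intro x c hc
    have h1 : l x = c := tendsto_nhds_unique (hLt x)
      (tendsto_const_nhds.congr' ((hc.filter_mono hu).mono fun n h => h.symm))
    refine tendsto_const_nhds.congr' (hc.mono fun n h => ?_)
    simp only [sub_apply, h, h1, sub_self]
  refine ⟨l, hL, fun x => ?_⟩
  have h := tendsto_zero_of_generators (fun n => evalXA 𝕜 𝒜 n - l) (l := cofinite ⊓ 𝓟 A) (M := 2)
    (fun n x => by
      rw [sub_apply]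
      have h1 := norm_sub_le (evalXA 𝕜 𝒜 n x) (l x)
      have h2 := norm_evalXA_le n x
      have h3 := hL x
      rw [← hlL] at h3
      linarith)
    (fun A' hA' => by
      by_cases hAA : A = A'
      · subst hAA
        refine hev _ 1 ?_
        filter_upwards [mem_inf_of_right (mem_principal_self A)] with n hn
        rw [evalXA_mk, indLinf_apply, if_pos hn]
      · refine hev _ 0 ?_
        filter_upwards [mem_inf_of_right (mem_principal_self A),
          mem_inf_of_left (h_ad A hA A' hA' hAA).compl_mem_cofinite] with n hn hn'
        rw [evalXA_mk, indLinf_apply, if_neg fun h => hn' ⟨hn, h⟩])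
    (fun m => by
      refine hev _ 0 ?_
      filter_upwards [mem_inf_of_left (Set.finite_singleton m).compl_mem_cofinite] with n hn
      rw [evalXA_mk, indLinf_apply, if_neg hn]) x
  simpa using h.add_const (l x)

end LimitFunctionals

section CopiesOfC0

variable {𝕜 : Type*} [RCLike 𝕜] {𝒜 : Set (Set ℕ)}

/-- An operator into `X_𝒜` which is bounded below on a `c₀`-sequence fixes a copy of `c₀`, with
control of the constants. -/
theorem IsC0Bounded.exists_factor_id_XA
    (h_inf : ∀ A ∈ 𝒜, A.Infinite)
    (h_ad : ∀ A ∈ 𝒜, ∀ A' ∈ 𝒜, A ≠ A' → (A ∩ A').Finite)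
    {E : Type*} [NormedAddCommGroup E] [NormedSpace 𝕜 E] [CompleteSpace E]
    {z : ℕ → E} {M : ℝ} (hz : IsC0Bounded 𝕜 z M) (T : E →L[𝕜] ↥(XA 𝕜 𝒜)) {δ : ℝ} (hδ : 0 < δ)
    (hT : ∀ k, δ < ‖T (z k)‖) :
    ∃ (R : C₀(ℕ, 𝕜) →L[𝕜] E) (S : ↥(XA 𝕜 𝒜) →L[𝕜] C₀(ℕ, 𝕜)), ‖R‖ ≤ M ∧ ‖S‖ ≤ 8 / δ ∧
      S ∘L T ∘L R = ContinuousLinearMap.id 𝕜 C₀(ℕ, 𝕜) := by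
  classical
  have hex : ∀ k, ∃ n, δ < ‖evalXA 𝕜 𝒜 n (T (z k))‖ := by
    intro k
    by_contra! h
    exact absurd (norm_XA_le hδ.le h) (not_le.2 (hT k))
  choose n hn using hex
  have hnt : Tendsto n atTop cofinite := by
    refine le_cofinite_iff_eventually_ne.2 fun m => eventually_map.2 ?_
    have h := (hz.tendsto_apply (evalXA 𝕜 𝒜 m ∘L T)).norm.eventually_lt_const
      (by rwa [norm_zero] : ‖(0 : 𝕜)‖ < δ)
    filter_upwards [h] with k hk hkm
    subst hkm
    exact lt_asymm hk (hn k)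
  suffices h : ∃ (g : ℕ → ℕ) (l : ↥(XA 𝕜 𝒜) →L[𝕜] 𝕜), StrictMono g ∧ (∀ x, ‖l x‖ ≤ ‖x‖) ∧
      (∀ x, Tendsto (fun k => evalXA 𝕜 𝒜 (n (g k)) x) atTop (𝓝 (l x))) ∧
      ∀ k, ‖l (T (z (g k)))‖ ≤ δ / 2 by
    obtain ⟨g, l, hg, hl, hlt, hlz⟩ := h
    have h8 : 8 / δ = 4 / (δ / 2) := by field_simp; norm_num
    rw [h8]
    refine (hz.comp hg).exists_factor_id T (fun k => evalXA 𝕜 𝒜 (n (g k)) - l) (fun k x => ?_)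
      (fun x => ?_) (half_pos hδ) (fun k => ?_)
    · rw [sub_apply]
      linarith [norm_sub_le (evalXA 𝕜 𝒜 (n (g k)) x) (l x), norm_evalXA_le (n (g k)) x, hl x]
    · simpa using (hlt x).sub_const (l x)
    · simp only [sub_apply]
      linarith [norm_sub_norm_le (evalXA 𝕜 𝒜 (n (g k)) (T (z (g k)))) (l (T (z (g k)))),
        hn (g k), hlz k]
  by_cases hA : ∃ A ∈ 𝒜, ∃ᶠ k in atTop, n k ∈ A
  · obtain ⟨A, hA, hfr⟩ := hA
    obtain ⟨l, hl, hlt⟩ := exists_limit_functional (𝕜 := 𝕜) h_ad hA (h_inf A hA)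
    have hsmall : ∀ᶠ k in atTop, ‖l (T (z k))‖ ≤ δ / 2 := by
      refine (hz.tendsto_apply (l ∘L T)).norm.eventually_le_const ?_
      rw [norm_zero]; positivity
    obtain ⟨g, hg, hgA⟩ := extraction_of_frequently_atTop (hfr.and_eventually hsmall)
    refine ⟨g, l, hg, hl, fun x => (hlt x).comp ?_, fun k => (hgA k).2⟩
    exact tendsto_inf.2 ⟨hnt.comp hg.tendsto_atTop,
      tendsto_principal.2 (Eventually.of_forall fun k => (hgA k).1)⟩
  · push Not at hA
    refine ⟨id, 0, strictMono_id, by simp, fun x => ?_, fun k => by simp; positivity⟩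
    refine tendsto_zero_of_generators (fun k => evalXA 𝕜 𝒜 (n k)) (M := 1)
      (fun k x => by simpa using norm_evalXA_le (n k) x) (fun A h => ?_) (fun m => ?_) x
    · refine tendsto_const_nhds.congr' ((hA A h).mono fun k hk => ?_)
      simp only [evalXA_mk, indLinf_apply, if_neg hk]
    · refine tendsto_const_nhds.congr'
        ((hnt.eventually (Set.finite_singleton m).compl_mem_cofinite).mono fun k hk => ?_)
      simp only [evalXA_mk, indLinf_apply, if_neg hk]

/-- `X_𝒜` contains a complemented copy of `c₀`. -/
theorem exists_complemented_c0 (𝕜 : Type*) [RCLike 𝕜]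
    (h_inf : ∀ A ∈ 𝒜, A.Infinite)
    (h_ad : ∀ A ∈ 𝒜, ∀ A' ∈ 𝒜, A ≠ A' → (A ∩ A').Finite) :
    ∃ (α : C₀(ℕ, 𝕜) →L[𝕜] ↥(XA 𝕜 𝒜)) (β : ↥(XA 𝕜 𝒜) →L[𝕜] C₀(ℕ, 𝕜)),
      β ∘L α = ContinuousLinearMap.id 𝕜 C₀(ℕ, 𝕜) := by
  classical
  let z : ℕ → ↥(XA 𝕜 𝒜) := fun n => ⟨indLinf 𝕜 {n}, indLinf_singleton_mem_XA n⟩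
  have hzn : ∀ k n, evalXA 𝕜 𝒜 n (z k) = if n = k then 1 else 0 := fun k n =>
    indLinf_apply {k} n
  have hz : IsC0Bounded 𝕜 z 1 := by
    intro s c hc
    refine norm_XA_le zero_le_one fun n => ?_
    simp only [map_sum, map_smul, hzn, smul_eq_mul, mul_ite, mul_one, mul_zero,
      Finset.sum_ite_eq]
    split_ifs with h
    · exact hc n h
    · simp
  obtain ⟨R, S, -, -, h⟩ := hz.exists_factor_id_XA h_inf h_ad
    (ContinuousLinearMap.id 𝕜 ↥(XA 𝕜 𝒜)) (δ := 1 / 2) (by norm_num) (fun k => by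
      have h := norm_evalXA_le k (z k)
      rw [hzn, if_pos rfl, norm_one] at h
      rw [ContinuousLinearMap.id_apply]
      linarith)
  exact ⟨R, S, h⟩

theorem sum_indicator_jump_le_one {P : ℕ → Prop} (hP : ∀ k, P k → P (k + 1)) (s : Finset ℕ)
    [DecidablePred fun k => P (k + 1) ∧ ¬P k] :
    ∑ k ∈ s, (if P (k + 1) ∧ ¬P k then 1 else 0 : ℝ) ≤ 1 := by
  have hmono : ∀ i j, i ≤ j → P i → P j := fun i j hij hi =>
    Nat.le_induction hi (fun k _ => hP k) j hij
  rw [Finset.sum_boole]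
  norm_cast
  refine Finset.card_le_one.2 fun i hi j hj => ?_
  have hi := (Finset.mem_filter.1 hi).2
  have hj := (Finset.mem_filter.1 hj).2
  by_contra hij
  rcases Ne.lt_or_gt hij with h | h
  · exact hj.2 (hmono _ _ h hi.1)
  · exact hi.2 (hmono _ _ h hj.1)

/-- An operator on `X_𝒜` which is far from the finite-rank operators is bounded below on some
`c₀`-sequence. -/
theorem exists_isC0Bounded_of_forall_finrank_lt
    (h_inf : ∀ A ∈ 𝒜, A.Infinite)
    (h_ad : ∀ A ∈ 𝒜, ∀ A' ∈ 𝒜, A ≠ A' → (A ∩ A').Finite)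
    (T : ↥(XA 𝕜 𝒜) →L[𝕜] ↥(XA 𝕜 𝒜)) {δ : ℝ}
    (hT : ∀ P ∈ Submodule.span 𝕜 (Set.range
      fun p : (↥(XA 𝕜 𝒜) →L[𝕜] 𝕜) × ↥(XA 𝕜 𝒜) => p.1.smulRight p.2), δ < ‖T - T ∘L P‖) :
    ∃ z, IsC0Bounded 𝕜 z 3 ∧ ∀ k, δ < ‖T (z k)‖ := by
  classical
  choose l hl hlt using fun A : 𝒜 => exists_limit_functional (𝕜 := 𝕜) h_ad A.2 (h_inf A A.2)
  have hne : ∀ A : 𝒜, (cofinite ⊓ 𝓟 (A : Set ℕ)).NeBot := fun A =>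
    cofinite_inf_principal_neBot_iff.2 (h_inf A A.2)
  have hlA : ∀ A A' : 𝒜, l A ⟨indLinf 𝕜 A', indLinf_mem_XA A'.2⟩ = if A = A' then 1 else 0 := by
    intro A A'
    have := hne A
    refine tendsto_nhds_unique (hlt A _) (tendsto_const_nhds.congr' ?_)
    split_ifs with hAA
    · subst hAA
      filter_upwards [mem_inf_of_right (mem_principal_self (A : Set ℕ))] with n hn
      rw [evalXA_mk, indLinf_apply, if_pos hn]
    · filter_upwards [mem_inf_of_right (mem_principal_self (A : Set ℕ)), mem_inf_of_left
        (h_ad A A.2 A' A'.2 fun h => hAA (Subtype.ext h)).compl_mem_cofinite] with n hn hn'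
      rw [evalXA_mk, indLinf_apply, if_neg fun h => hn' ⟨hn, h⟩]
  have hln : ∀ (A : 𝒜) m, l A ⟨indLinf 𝕜 {m}, indLinf_singleton_mem_XA m⟩ = 0 := by
    intro A m
    have := hne A
    refine tendsto_nhds_unique (hlt A _) (tendsto_const_nhds.congr' ?_)
    filter_upwards [mem_inf_of_left (Set.finite_singleton m).compl_mem_cofinite] with n hn
    rw [evalXA_mk, indLinf_apply, if_neg hn]
  have hfin : ∀ σ : Finset ℕ × Finset 𝒜,
      {n | n ∈ σ.1 ∨ ∃ A ∈ σ.2, ∃ A' ∈ σ.2, A ≠ A' ∧ n ∈ (A : Set ℕ) ∩ A'}.Finite := by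
    intro σ
    refine σ.1.finite_toSet.union ?_
    have h : {n | ∃ A ∈ σ.2, ∃ A' ∈ σ.2, A ≠ A' ∧ n ∈ (A : Set ℕ) ∩ A'} ⊆
        ⋃ A ∈ σ.2, ⋃ A' ∈ σ.2, ⋃ _ : A ≠ A', (A : Set ℕ) ∩ A' := by
      rintro n ⟨A, hA, A', hA', hAA, hn⟩
      simp only [Set.mem_iUnion]
      exact ⟨A, hA, A', hA', hAA, hn⟩
    refine Set.Finite.subset (σ.2.finite_toSet.biUnion fun A _ => σ.2.finite_toSet.biUnion
      fun A' _ => Set.finite_iUnion fun hAA => ?_) h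
    exact h_ad A A.2 A' A'.2 fun h => hAA (Subtype.ext h)
  let F : Finset ℕ × Finset 𝒜 → Finset ℕ := fun σ => (hfin σ).toFinset
  have hF : ∀ σ n, n ∈ F σ ↔
      n ∈ σ.1 ∨ ∃ A ∈ σ.2, ∃ A' ∈ σ.2, A ≠ A' ∧ n ∈ (A : Set ℕ) ∩ A' := fun σ n =>
    (hfin σ).mem_toFinset
  have hFmono : ∀ σ τ, σ ≤ τ → ∀ n ∈ F σ, n ∈ F τ := by
    intro σ τ h n hn
    rw [hF] at hn ⊢
    rcases hn with hn | ⟨A, hA, A', hA', hn⟩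
    · exact Or.inl (h.1 hn)
    · exact Or.inr ⟨A, h.2 hA, A', h.2 hA', hn⟩
  let Q : Finset ℕ × Finset 𝒜 → ↥(XA 𝕜 𝒜) →L[𝕜] ↥(XA 𝕜 𝒜) := fun σ =>
    ∑ m ∈ F σ, (evalXA 𝕜 𝒜 m).smulRight ⟨indLinf 𝕜 {m}, indLinf_singleton_mem_XA m⟩ +
      ∑ A ∈ σ.2, (l A).smulRight ⟨indLinf 𝕜 (A \ F σ), indLinf_diff_mem_XA A.2 (F σ)⟩
  have hQspan : ∀ σ, Q σ ∈ Submodule.span 𝕜 (Set.range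
      fun p : (↥(XA 𝕜 𝒜) →L[𝕜] 𝕜) × ↥(XA 𝕜 𝒜) => p.1.smulRight p.2) := fun σ =>
    add_mem (sum_mem fun m _ => Submodule.subset_span ⟨(_, _), rfl⟩)
      (sum_mem fun A _ => Submodule.subset_span ⟨(_, _), rfl⟩)
  have hQ : ∀ σ x n, evalXA 𝕜 𝒜 n (Q σ x) = (if n ∈ F σ then evalXA 𝕜 𝒜 n x else 0) +
      ∑ A ∈ σ.2, if n ∈ (A : Set ℕ) ∧ n ∉ F σ then l A x else 0 := by
    intro σ x n
    simp only [Q, add_apply, sum_apply, map_add, map_sum, ContinuousLinearMap.smulRight_apply,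
      map_smul, evalXA_mk, indLinf_apply, Set.mem_singleton_iff, smul_eq_mul, mul_ite, mul_one,
      mul_zero, Finset.sum_ite_eq, Set.mem_sdiff, Finset.mem_coe]
  have hQF : ∀ σ x n, n ∈ F σ → evalXA 𝕜 𝒜 n (Q σ x) = evalXA 𝕜 𝒜 n x := by
    intro σ x n hn
    simp [hQ, hn]
  have hQA : ∀ σ x n (A : 𝒜), n ∉ F σ → A ∈ σ.2 → n ∈ (A : Set ℕ) →
      evalXA 𝕜 𝒜 n (Q σ x) = l A x := by
    intro σ x n A hn hA hnA
    rw [hQ, if_neg hn, zero_add, Finset.sum_eq_single_of_mem A hA, if_pos ⟨hnA, hn⟩]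
    intro A' hA' hAA
    rw [if_neg]
    rintro ⟨hnA', -⟩
    exact hn ((hF σ n).2 (Or.inr ⟨A', hA', A, hA, hAA, hnA', hnA⟩))
  have hQ0 : ∀ σ x n, n ∉ F σ → (∀ A ∈ σ.2, n ∉ (A : Set ℕ)) → evalXA 𝕜 𝒜 n (Q σ x) = 0 := by
    intro σ x n hn hA
    rw [hQ, if_neg hn, zero_add]
    exact Finset.sum_eq_zero fun A h => if_neg fun h' => hA A h h'.1
  have hQle : ∀ σ x n, ‖evalXA 𝕜 𝒜 n (Q σ x)‖ ≤ ‖x‖ := by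
    intro σ x n
    by_cases hn : n ∈ F σ
    · rw [hQF σ x n hn]; exact norm_evalXA_le n x
    by_cases hA : ∃ A ∈ σ.2, n ∈ (A : Set ℕ)
    · obtain ⟨A, hA, hnA⟩ := hA
      rw [hQA σ x n A hn hA hnA]; exact hl A x
    · push Not at hA
      rw [hQ0 σ x n hn hA, norm_zero]; exact norm_nonneg x
  have hQt : ∀ x, Tendsto (fun σ => Q σ x) atTop (𝓝 x) := by
    intro x
    have h := tendsto_zero_of_generators
      (fun σ => Q σ - ContinuousLinearMap.id 𝕜 ↥(XA 𝕜 𝒜)) (l := atTop) (M := 2)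
      (fun σ x => by
        have h1 := norm_sub_le (Q σ x) x
        have h2 : ‖Q σ x‖ ≤ ‖x‖ := norm_XA_le (norm_nonneg x) (hQle σ x)
        rw [sub_apply, ContinuousLinearMap.id_apply]
        linarith)
      (fun A hA => by
        refine tendsto_const_nhds.congr' ?_
        filter_upwards [eventually_ge_atTop (∅, {⟨A, hA⟩})] with σ hσ
        have hAσ : (⟨A, hA⟩ : 𝒜) ∈ σ.2 := hσ.2 (Finset.mem_singleton_self _)
        rw [sub_apply, ContinuousLinearMap.id_apply, eq_comm, sub_eq_zero]
        refine XA_ext fun n => ?_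
        by_cases hn : n ∈ F σ
        · exact hQF σ _ n hn
        by_cases hA' : ∃ A' ∈ σ.2, n ∈ (A' : Set ℕ)
        · obtain ⟨A', hA', hnA'⟩ := hA'
          rw [hQA σ _ n A' hn hA' hnA', hlA A' ⟨A, hA⟩, evalXA_mk, indLinf_apply]
          refine if_congr ⟨fun h => ?_, fun h => ?_⟩ rfl rfl
          · subst h; exact hnA'
          · by_contra hne'
            exact hn ((hF σ n).2 (Or.inr ⟨A', hA', _, hAσ, hne', hnA', h⟩))
        · push Not at hA'
          rw [hQ0 σ _ n hn hA', evalXA_mk, indLinf_apply, if_neg (hA' _ hAσ)])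
      (fun m => by
        refine tendsto_const_nhds.congr' ?_
        filter_upwards [eventually_ge_atTop ({m}, ∅)] with σ hσ
        have hmσ : m ∈ F σ := (hF σ m).2 (Or.inl (hσ.1 (Finset.mem_singleton_self m)))
        rw [sub_apply, ContinuousLinearMap.id_apply, eq_comm, sub_eq_zero]
        refine XA_ext fun n => ?_
        by_cases hn : n ∈ F σ
        · exact hQF σ _ n hn
        have hnm : n ∉ ({m} : Set ℕ) := fun h => hn (by rwa [Set.mem_singleton_iff.1 h])
        have hval : evalXA 𝕜 𝒜 n ⟨indLinf 𝕜 {m}, indLinf_singleton_mem_XA m⟩ = 0 := by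
          rw [evalXA_mk, indLinf_apply, if_neg hnm]
        rw [hval]
        by_cases hA' : ∃ A' ∈ σ.2, n ∈ (A' : Set ℕ)
        · obtain ⟨A', hA', hnA'⟩ := hA'
          rw [hQA σ _ n A' hn hA' hnA', hln]
        · push Not at hA'
          exact hQ0 σ _ n hn hA') x
    simpa using h.add_const x
  have hstep : ∀ σ, ∃ x τ, ‖x‖ < 1 ∧ σ ≤ τ ∧ δ < ‖T (Q τ x - Q σ x)‖ := by
    intro σ
    obtain ⟨x, hx, hTx⟩ := (T - T ∘L Q σ).exists_lt_apply_of_lt_opNorm (hT _ (hQspan σ))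
    have hc : Tendsto (fun τ => ‖T (Q τ x - Q σ x)‖) atTop (𝓝 ‖T (x - Q σ x)‖) :=
      ((T.continuous.tendsto _).comp ((hQt x).sub_const _)).norm
    have hTx' : δ < ‖T (x - Q σ x)‖ := by simpa using hTx
    obtain ⟨τ, h1, h2⟩ := ((hc.eventually_const_lt hTx').and (eventually_ge_atTop σ)).exists
    exact ⟨x, τ, hx, h2, h1⟩
  choose y τ hy hτ hTy using hstep
  let s : ℕ → Finset ℕ × Finset 𝒜 := fun k => τ^[k] (∅, ∅)
  have hs : ∀ k, s (k + 1) = τ (s k) := fun k => Function.iterate_succ_apply' τ k _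
  have hsle : ∀ k, s k ≤ s (k + 1) := fun k => by rw [hs]; exact hτ _
  refine ⟨fun k => Q (s (k + 1)) (y (s k)) - Q (s k) (y (s k)), fun t c hc => ?_, fun k => ?_⟩
  swap
  · simp only [hs]; exact hTy _
  refine norm_XA_le (by norm_num) fun n => ?_
  let P : ℕ → Prop := fun k => n ∈ F (s k)
  let P' : ℕ → Prop := fun k => ∃ A ∈ (s k).2, n ∈ (A : Set ℕ)
  have hP : ∀ k, P k → P (k + 1) := fun k => hFmono _ _ (hsle k) n
  have hP' : ∀ k, P' k → P' (k + 1) := fun k ⟨A, hA, h⟩ => ⟨A, (hsle k).2 hA, h⟩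
  have hyle : ∀ k σ, ‖evalXA 𝕜 𝒜 n (Q σ (y (s k)))‖ ≤ 1 := fun k σ =>
    (hQle _ _ _).trans (hy _).le
  have hterm : ∀ k, ‖evalXA 𝕜 𝒜 n (Q (s (k + 1)) (y (s k)) - Q (s k) (y (s k)))‖ ≤
      2 * (if P (k + 1) ∧ ¬P k then 1 else 0) + (if P' (k + 1) ∧ ¬P' k then 1 else 0) := by
    intro k
    have hi : ∀ p : Prop, [Decidable p] → (0 : ℝ) ≤ if p then 1 else 0 := fun p _ => by
      split_ifs <;> norm_num
    rw [map_sub]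
    by_cases h1 : P (k + 1)
    · by_cases h0 : P k
      · rw [hQF _ _ n h1, hQF _ _ n h0, sub_self, norm_zero]
        linarith [hi (P (k + 1) ∧ ¬P k), hi (P' (k + 1) ∧ ¬P' k)]
      · rw [if_pos ⟨h1, h0⟩]
        linarith [hi (P' (k + 1) ∧ ¬P' k), norm_sub_le (evalXA 𝕜 𝒜 n (Q (s (k + 1)) (y (s k))))
          (evalXA 𝕜 𝒜 n (Q (s k) (y (s k)))), hyle k (s (k + 1)), hyle k (s k)]
    · have h0 : ¬P k := fun h => h1 (hP k h)
      by_cases h1' : P' (k + 1)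
      · by_cases h0' : P' k
        · obtain ⟨A, hA, hnA⟩ := h0'
          rw [hQA _ _ n A h1 ((hsle k).2 hA) hnA, hQA _ _ n A h0 hA hnA, sub_self, norm_zero]
          linarith [hi (P (k + 1) ∧ ¬P k), hi (P' (k + 1) ∧ ¬P' k)]
        · rw [if_pos (show P' (k + 1) ∧ ¬P' k from ⟨h1', h0'⟩)]
          have h := hyle k (s (k + 1))
          rw [hQ0 (s k) _ n h0 (by simpa [P'] using h0'), sub_zero]
          linarith [hi (P (k + 1) ∧ ¬P k)]
      · have h0' : ¬P' k := fun h => h1' (hP' k h)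
        rw [hQ0 (s k) _ n h0 (by simpa [P'] using h0'),
          hQ0 (s (k + 1)) _ n h1 (by simpa [P'] using h1'), sub_self, norm_zero]
        linarith [hi (P (k + 1) ∧ ¬P k), hi (P' (k + 1) ∧ ¬P' k)]
  rw [map_sum]
  calc ‖∑ k ∈ t, evalXA 𝕜 𝒜 n (c k • (Q (s (k + 1)) (y (s k)) - Q (s k) (y (s k))))‖
      ≤ ∑ k ∈ t, (2 * (if P (k + 1) ∧ ¬P k then 1 else 0 : ℝ) +
          (if P' (k + 1) ∧ ¬P' k then 1 else 0)) := by
        refine norm_sum_le_of_le t fun k hk => ?_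
        rw [map_smul, norm_smul]
        exact (mul_le_of_le_one_left (norm_nonneg _) (hc k hk)).trans (hterm k)
    _ ≤ 2 * 1 + 1 := by
        rw [Finset.sum_add_distrib, ← Finset.mul_sum]
        gcongr
        · exact sum_indicator_jump_le_one hP t
        · exact sum_indicator_jump_le_one hP' t
    _ = 3 := by norm_num

end CopiesOfC0

section ClosedRange

variable {𝕜 : Type*} [RCLike 𝕜] {E : Type*} [NormedAddCommGroup E] [NormedSpace 𝕜 E]
  {B : Type*} [NonUnitalNormedRing B] [NormedSpace 𝕜 B]

/-- If every operator is a scalar plus an operator through `c₀`, then a homomorphism which kills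
the operators through `c₀` has finite-dimensional range. -/
theorem isClosed_range_of_map_eq_zero
    (φ : (E →L[𝕜] E) →ₙₐ[𝕜] B)
    (h_few : ∀ T : E →L[𝕜] E, ∃ (c : 𝕜) (V : E →L[𝕜] C₀(ℕ, 𝕜)) (U : C₀(ℕ, 𝕜) →L[𝕜] E),
      T = c • ContinuousLinearMap.id 𝕜 E + U ∘L V)
    {α : C₀(ℕ, 𝕜) →L[𝕜] E} {β : E →L[𝕜] C₀(ℕ, 𝕜)}
    (hβα : β ∘L α = ContinuousLinearMap.id 𝕜 C₀(ℕ, 𝕜)) (h0 : φ (α ∘L β) = 0) :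
    IsClosed (Set.range φ) := by
  have hUV : ∀ (U : C₀(ℕ, 𝕜) →L[𝕜] E) (V : E →L[𝕜] C₀(ℕ, 𝕜)), φ (U ∘L V) = 0 := by
    intro U V
    have h : U ∘L V = (U ∘L β) * (α ∘L β) * (α ∘L V) := by
      ext x
      have hx := fun c => DFunLike.congr_fun hβα c
      simp only [ContinuousLinearMap.comp_apply, ContinuousLinearMap.id_apply] at hx
      simp [hx]
    rw [h, map_mul, map_mul, h0, mul_zero, zero_mul]
  have hrange : Set.range φ = (𝕜 ∙ φ (ContinuousLinearMap.id 𝕜 E) : Submodule 𝕜 B) := by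
    ext b
    rw [SetLike.mem_coe, Submodule.mem_span_singleton]
    constructor
    · rintro ⟨T, rfl⟩
      obtain ⟨c, V, U, rfl⟩ := h_few T
      exact ⟨c, by rw [map_add, map_smul, hUV, add_zero]⟩
    · rintro ⟨c, rfl⟩
      exact ⟨c • ContinuousLinearMap.id 𝕜 E, map_smul φ c _⟩
  rw [hrange]
  exact Submodule.closed_of_finiteDimensional _

/-- Suppose that every operator far from the finite-rank operators fixes a copy of `c₀`, with
control of the constants. Then a bounded homomorphism which kills the rank-one operators, but not
a given operator through `c₀`, is controlled modulo its kernel. -/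
theorem exists_map_eq_norm_le
    (hfix : ∀ (T : E →L[𝕜] E) (δ : ℝ), 0 < δ →
      (∀ P ∈ Submodule.span 𝕜 (Set.range fun p : (E →L[𝕜] 𝕜) × E => p.1.smulRight p.2),
        δ < ‖T - T ∘L P‖) →
      ∃ (R : C₀(ℕ, 𝕜) →L[𝕜] E) (S : E →L[𝕜] C₀(ℕ, 𝕜)), ‖R‖ ≤ 3 ∧ ‖S‖ ≤ 8 / δ ∧
        S ∘L T ∘L R = ContinuousLinearMap.id 𝕜 C₀(ℕ, 𝕜))
    (φ : (E →L[𝕜] E) →ₙₐ[𝕜] B) {C : ℝ} (hC0 : 0 ≤ C) (hC : ∀ T, ‖φ T‖ ≤ C * ‖T‖)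
    (hrank : ∀ (f : E →L[𝕜] 𝕜) (y : E), φ (f.smulRight y) = 0)
    {α : C₀(ℕ, 𝕜) →L[𝕜] E} {β : E →L[𝕜] C₀(ℕ, 𝕜)} (h0 : φ (α ∘L β) ≠ 0) :
    ∃ C', ∀ T, ∃ T', φ T' = φ T ∧ ‖T'‖ ≤ C' * ‖φ T‖ := by
  have hpos : 0 < ‖φ (α ∘L β)‖ := norm_pos_iff.2 h0
  let K : ℝ := C * (‖α‖ * 8) * (C * (3 * ‖β‖))
  have hK : 0 ≤ K := by positivity
  have hC' : 0 < (K + 1) / ‖φ (α ∘L β)‖ := by positivity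
  refine ⟨(K + 1) / ‖φ (α ∘L β)‖, fun T => ?_⟩
  by_cases hT : φ T = 0
  · exact ⟨0, by rw [hT, map_zero], by
      exact ContinuousLinearMap.opNorm_zero.trans_le (by positivity)⟩
  have hTpos : 0 < ‖φ T‖ := norm_pos_iff.2 hT
  by_contra! hcon
  have hδ : 0 < (K + 1) / ‖φ (α ∘L β)‖ * ‖φ T‖ := mul_pos hC' hTpos
  obtain ⟨R, S, hR, hS, hSTR⟩ := hfix T _ hδ fun P hP => by
    refine hcon (T - T ∘L P) ?_
    have hφP : φ P = 0 := by
      have hle : Submodule.span 𝕜 (Set.range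
          fun p : (E →L[𝕜] 𝕜) × E => p.1.smulRight p.2) ≤
          LinearMap.ker (φ : (E →L[𝕜] E) →ₗ[𝕜] B) := by
        rw [Submodule.span_le]
        rintro _ ⟨p, rfl⟩
        exact hrank p.1 p.2
      exact hle hP
    have hmul : φ (T ∘L P) = φ T * φ P := map_mul φ T P
    rw [map_sub, hmul, hφP, mul_zero, sub_zero]
  set δ := (K + 1) / ‖φ (α ∘L β)‖ * ‖φ T‖ with hδdef
  have hfac : α ∘L β = (α ∘L S) * T * (R ∘L β) := by
    ext x : 1
    have hx := DFunLike.congr_fun hSTR (β x)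
    simp only [ContinuousLinearMap.comp_apply, ContinuousLinearMap.id_apply] at hx
    simp [hx]
  have hαS : ‖φ (α ∘L S)‖ ≤ C * (‖α‖ * (8 / δ)) := (hC _).trans (by
    gcongr
    exact (α.opNorm_comp_le S).trans (by gcongr))
  have hRβ : ‖φ (R ∘L β)‖ ≤ C * (3 * ‖β‖) := (hC _).trans (by
    gcongr
    exact (R.opNorm_comp_le β).trans (by gcongr))
  have h1 : ‖φ (α ∘L β)‖ ≤ C * (‖α‖ * (8 / δ)) * ‖φ T‖ * (C * (3 * ‖β‖)) := by
    calc ‖φ (α ∘L β)‖ = ‖φ ((α ∘L S) * T * (R ∘L β))‖ := by rw [← hfac]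
      _ ≤ ‖φ (α ∘L S)‖ * ‖φ T‖ * ‖φ (R ∘L β)‖ := by
          rw [map_mul, map_mul]
          exact (norm_mul_le _ _).trans (by gcongr; exact norm_mul_le _ _)
      _ ≤ _ := by gcongr
  have h2 : C * (‖α‖ * (8 / δ)) * ‖φ T‖ * (C * (3 * ‖β‖)) =
      K / (K + 1) * ‖φ (α ∘L β)‖ := by
    have hK1 : K + 1 ≠ 0 := by positivity
    rw [hδdef]
    field_simp
    simp only [K]
    ring
  rw [h2, div_mul_eq_mul_div, le_div_iff₀ (by positivity)] at h1
  nlinarith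

end ClosedRange

/-- Let `𝒜` be an uncountable almost disjoint family of infinite subsets
of `ℕ`, and suppose that `X_𝒜` admits few operators, i.e. every bounded operator on `X_𝒜`
is a scalar multiple of the identity plus an operator factoring through `c₀`. Then every
homomorphism from `B(X_𝒜)` into a Banach algebra is continuous and has closed range. -/
theorem statement2 {𝕜 : Type*} [RCLike 𝕜] (𝒜 : Set (Set ℕ))
    (h_inf : ∀ A ∈ 𝒜, A.Infinite)
    (h_ad : ∀ A ∈ 𝒜, ∀ A' ∈ 𝒜, A ≠ A' → (A ∩ A').Finite)
    (h_unc : ¬𝒜.Countable)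
    (h_few : ∀ T : ↥(XA 𝕜 𝒜) →L[𝕜] ↥(XA 𝕜 𝒜),
      ∃ (c : 𝕜) (V : ↥(XA 𝕜 𝒜) →L[𝕜] C₀(ℕ, 𝕜)) (U : C₀(ℕ, 𝕜) →L[𝕜] ↥(XA 𝕜 𝒜)),
        T = c • ContinuousLinearMap.id 𝕜 ↥(XA 𝕜 𝒜) + U ∘L V)
    (B : Type*) [NonUnitalNormedRing B] [NormedSpace 𝕜 B]
    [IsScalarTower 𝕜 B B] [SMulCommClass 𝕜 B B] [CompleteSpace B]
    (φ : (↥(XA 𝕜 𝒜) →L[𝕜] ↥(XA 𝕜 𝒜)) →ₙₐ[𝕜] B) :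
    Continuous φ ∧ IsClosed (Set.range φ) := by
  obtain ⟨α, β, hβα⟩ := exists_complemented_c0 𝕜 h_inf h_ad
  obtain ⟨D, hD⟩ := continuous_of_few_operators φ h_few hβα
  obtain ⟨C, hC0, hC⟩ : ∃ C : ℝ, 0 ≤ C ∧ ∀ T, ‖φ T‖ ≤ C * ‖T‖ :=
    ⟨max D 0, le_max_right _ _, fun T => (hD T).trans (by gcongr; exact le_max_left _ _)⟩
  refine ⟨AddMonoidHomClass.continuous_of_bound φ C hC, ?_⟩
  by_cases h0 : φ (α ∘L β) = 0
  · exact isClosed_range_of_map_eq_zero φ h_few hβα h0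
  by_cases hrank : ∀ (f : ↥(XA 𝕜 𝒜) →L[𝕜] 𝕜) (y : ↥(XA 𝕜 𝒜)), φ (f.smulRight y) = 0
  · obtain ⟨C', hC'⟩ := exists_map_eq_norm_le (fun T δ hδ hT => by
      obtain ⟨z, hz, hTz⟩ := exists_isC0Bounded_of_forall_finrank_lt h_inf h_ad T hT
      exact hz.exists_factor_id_XA h_inf h_ad T hδ hTz) φ hC0 hC hrank h0
    exact isClosed_range_of_controlled φ hC hC'
  · push Not at hrank
    obtain ⟨f, y, hfy⟩ := hrank
    obtain ⟨C', hC'⟩ := exists_norm_le_of_map_rankOne_ne_zero φ hC0 hC hfy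
    exact isClosed_range_of_controlled φ hC fun T => ⟨T, rfl, hC' T⟩
end

section
/- Let K be a locally compact Hausdorff space, let Y be a Banach space whose dual unit ball is weak* sequentially compact, let T : C₀(K) → Y be a bounded linear operator, and let C > 0. Then C₀(K) contains a sequence (fₙ)_{n∈ℕ} such that sup_{k∈K} Σ_{n=1}^∞ |fₙ(k)| ≤ 1 and inf_{n∈ℕ} ‖T fₙ‖ > 1/C, if and only if there exist bounded linear operators U : Y → c₀ and V : c₀ → C₀(K) such that U∘T∘V = I_{c₀} and ‖U‖·‖V‖ < C. -/
open scoped ENNReal ZeroAtInfty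
open Filter

/-- The sequence `f` is dominated by the unit vector basis of `c₀`:
finite linear combinations with coefficients bounded by `M` have norm at most `M`. -/
def DominatedByC0 (𝕜 : Type*) [RCLike 𝕜] {X : Type*} [NormedAddCommGroup X] [NormedSpace 𝕜 X]
    (f : ℕ → X) : Prop :=
  ∀ (t : Finset ℕ) (c : ℕ → 𝕜) (M : ℝ), 0 ≤ M → (∀ m ∈ t, ‖c m‖ ≤ M) →
    ‖∑ m ∈ t, c m • f m‖ ≤ M

section

variable {𝕜 : Type*} [RCLike 𝕜]

theorem ZeroAtInftyContinuousMap.norm_le_iff {α : Type*} [TopologicalSpace α] (f : C₀(α, 𝕜))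
    {M : ℝ} (hM : 0 ≤ M) : ‖f‖ ≤ M ↔ ∀ x, ‖f x‖ ≤ M := by
  rw [← ZeroAtInftyContinuousMap.norm_toBCF_eq_norm, BoundedContinuousFunction.norm_le hM]
  rfl

theorem ZeroAtInftyContinuousMap.norm_apply_le {α : Type*} [TopologicalSpace α] (f : C₀(α, 𝕜))
    (x : α) : ‖f x‖ ≤ ‖f‖ :=
  (f.norm_le_iff (norm_nonneg f)).1 le_rfl x

theorem ZeroAtInftyContinuousMap.finset_sum_apply {α ι : Type*} [TopologicalSpace α]
    (t : Finset ι) (f : ι → C₀(α, 𝕜)) (x : α) : (∑ i ∈ t, f i) x = ∑ i ∈ t, f i x := by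
  classical
  induction t using Finset.induction_on with
  | empty => simp
  | insert a s ha ih => simp [Finset.sum_insert ha, ih]

theorem ZeroAtInftyContinuousMap.tendsto_atTop (x : C₀(ℕ, 𝕜)) :
    Tendsto (fun n => x n) atTop (nhds 0) :=
  cocompact_eq_atTop (α := ℕ) ▸ zero_at_infty x

theorem dominatedByC0_of_tsum_le_one {K : Type*} [TopologicalSpace K] {f : ℕ → C₀(K, 𝕜)}
    (hf : ∀ k : K, ∑' n : ℕ, (‖f n k‖₊ : ℝ≥0∞) ≤ 1) : DominatedByC0 𝕜 f := by
  intro t c M hM hc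
  rw [ZeroAtInftyContinuousMap.norm_le_iff _ hM]
  intro k
  rw [ZeroAtInftyContinuousMap.finset_sum_apply]
  have h1 : ∑ m ∈ t, ‖f m k‖ ≤ 1 := by
    have h := (ENNReal.sum_le_tsum t).trans (hf k)
    have h' : ((∑ m ∈ t, ‖f m k‖₊ : NNReal) : ℝ≥0∞) ≤ 1 := by
      rw [ENNReal.ofNNReal_finsetSum]; exact h
    have h'' : (∑ m ∈ t, ‖f m k‖₊ : NNReal) ≤ 1 := by exact_mod_cast h'
    simpa using NNReal.coe_le_coe.2 h''
  calc ‖∑ m ∈ t, (c m • f m) k‖ ≤ ∑ m ∈ t, M * ‖f m k‖ := by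
        refine norm_sum_le_of_le _ fun m hm => ?_
        rw [ZeroAtInftyContinuousMap.smul_apply, norm_smul]
        exact mul_le_mul_of_nonneg_right (hc m hm) (norm_nonneg _)
    _ = M * ∑ m ∈ t, ‖f m k‖ := by rw [Finset.mul_sum]
    _ ≤ M := mul_le_of_le_one_right hM h1

/-- The unit vectors of `c₀`. -/
noncomputable def c0Basis (𝕜 : Type*) [RCLike 𝕜] (n : ℕ) : C₀(ℕ, 𝕜) where
  toFun := Pi.single n 1
  continuous_toFun := continuous_of_discreteTopology
  zero_at_infty' := by
    rw [cocompact_eq_atTop]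
    refine tendsto_const_nhds.congr' ?_
    filter_upwards [eventually_gt_atTop n] with m hm
    rw [Pi.single_eq_of_ne hm.ne']

theorem c0Basis_apply (n m : ℕ) : c0Basis 𝕜 n m = if m = n then 1 else 0 := by
  change (Pi.single n 1 : ℕ → 𝕜) m = _
  rw [Pi.single_apply]

theorem dominatedByC0_c0Basis : DominatedByC0 𝕜 (c0Basis 𝕜) := by
  intro t c M hM hc
  rw [ZeroAtInftyContinuousMap.norm_le_iff _ hM]
  intro k
  rw [ZeroAtInftyContinuousMap.finset_sum_apply]
  by_cases hk : k ∈ t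
  · simpa [c0Basis_apply, hk] using hc k hk
  · simpa [c0Basis_apply, hk] using hM

theorem sum_norm_apply_le_of_c0 {K : Type*} [TopologicalSpace K]
    (V : C₀(ℕ, 𝕜) →L[𝕜] C₀(K, 𝕜)) (t : Finset ℕ) (k : K) :
    ∑ m ∈ t, ‖V (c0Basis 𝕜 m) k‖ ≤ ‖V‖ := by
  choose u hu huv using fun m => RCLike.exists_norm_eq_mul_self (V (c0Basis 𝕜 m) k)
  have h1 : ((∑ m ∈ t, ‖V (c0Basis 𝕜 m) k‖ : ℝ) : 𝕜) =
      V (∑ m ∈ t, u m • c0Basis 𝕜 m) k := by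
    rw [map_sum, ZeroAtInftyContinuousMap.finset_sum_apply, RCLike.ofReal_sum]
    refine Finset.sum_congr rfl fun m _ => ?_
    rw [huv, map_smul, ZeroAtInftyContinuousMap.smul_apply, smul_eq_mul]
  have h2 : ‖∑ m ∈ t, u m • c0Basis 𝕜 m‖ ≤ 1 :=
    dominatedByC0_c0Basis t u 1 zero_le_one fun m _ => (hu m).le
  calc ∑ m ∈ t, ‖V (c0Basis 𝕜 m) k‖ = ‖((∑ m ∈ t, ‖V (c0Basis 𝕜 m) k‖ : ℝ) : 𝕜)‖ := by
        rw [RCLike.norm_ofReal, abs_of_nonneg (Finset.sum_nonneg fun _ _ => norm_nonneg _)]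
    _ ≤ ‖V (∑ m ∈ t, u m • c0Basis 𝕜 m)‖ := by
        rw [h1]; exact ZeroAtInftyContinuousMap.norm_apply_le _ _
    _ ≤ ‖V‖ := V.unit_le_opNorm _ h2

theorem exists_tsum_le_one_of_factorization {K : Type*} [TopologicalSpace K]
    {Y : Type*} [NormedAddCommGroup Y] [NormedSpace 𝕜 Y] (T : C₀(K, 𝕜) →L[𝕜] Y) {C : ℝ}
    (U : Y →L[𝕜] C₀(ℕ, 𝕜)) (V : C₀(ℕ, 𝕜) →L[𝕜] C₀(K, 𝕜))
    (hUV : U ∘L T ∘L V = ContinuousLinearMap.id 𝕜 (C₀(ℕ, 𝕜))) (hC : ‖U‖ * ‖V‖ < C) :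
    ∃ f : ℕ → C₀(K, 𝕜),
      (∀ k : K, ∑' n : ℕ, (‖f n k‖₊ : ℝ≥0∞) ≤ 1) ∧ 1 / C < ⨅ n : ℕ, ‖T (f n)‖ := by
  have key : ∀ n, 1 ≤ ‖U‖ * ‖T (V (c0Basis 𝕜 n))‖ := fun n => by
    have h : U (T (V (c0Basis 𝕜 n))) = c0Basis 𝕜 n := congrArg (fun A => A (c0Basis 𝕜 n)) hUV
    calc (1 : ℝ) = ‖c0Basis 𝕜 n n‖ := by simp [c0Basis_apply]
      _ ≤ ‖c0Basis 𝕜 n‖ := ZeroAtInftyContinuousMap.norm_apply_le _ _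
      _ = ‖U (T (V (c0Basis 𝕜 n)))‖ := by rw [h]
      _ ≤ _ := U.le_opNorm _
  have hU : 0 < ‖U‖ := by
    refine (norm_nonneg U).lt_of_ne fun h => ?_
    have := key 0
    rw [← h, zero_mul] at this
    exact absurd this (by norm_num)
  have hV : 0 < ‖V‖ := by
    refine (norm_nonneg V).lt_of_ne fun h => ?_
    have hV0 : V (c0Basis 𝕜 0) = 0 := by
      have := V.le_opNorm (c0Basis 𝕜 0)
      rwa [← h, zero_mul, norm_le_zero_iff] at this
    have := key 0
    rw [hV0, map_zero, norm_zero, mul_zero] at this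
    exact absurd this (by norm_num)
  refine ⟨fun n => ((‖V‖⁻¹ : ℝ) : 𝕜) • V (c0Basis 𝕜 n), fun k => ?_, ?_⟩
  · refine ENNReal.summable.tsum_le_of_sum_le fun t => ?_
    have h : ∑ m ∈ t, ‖(((‖V‖⁻¹ : ℝ) : 𝕜) • V (c0Basis 𝕜 m)) k‖ ≤ 1 := by
      simp only [ZeroAtInftyContinuousMap.smul_apply, norm_smul, RCLike.norm_ofReal, abs_inv,
        abs_of_pos hV, ← Finset.mul_sum]
      rw [inv_mul_le_iff₀ hV, mul_one]
      exact sum_norm_apply_le_of_c0 V t k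
    have h' : ∑ m ∈ t, ‖(((‖V‖⁻¹ : ℝ) : 𝕜) • V (c0Basis 𝕜 m)) k‖₊ ≤ 1 :=
      NNReal.coe_le_coe.1 (by rw [NNReal.coe_sum]; exact h)
    rw [← ENNReal.ofNNReal_finsetSum]
    exact_mod_cast h'
  · have h : 1 / C < 1 / (‖U‖ * ‖V‖) := one_div_lt_one_div_of_lt (mul_pos hU hV) hC
    refine h.trans_le (le_ciInf fun n => ?_)
    rw [map_smul, norm_smul, RCLike.norm_ofReal, abs_inv, abs_of_pos hV,
      div_le_iff₀ (mul_pos hU hV)]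
    calc 1 ≤ ‖U‖ * ‖T (V (c0Basis 𝕜 n))‖ := key n
      _ = _ := by field_simp

theorem exists_strictMono_offDiag_le {A : ℕ → ℕ → ℝ} {b : ℕ → ℝ}
    (hrow : ∀ i, Tendsto (A i) atTop (nhds 0))
    (hcol : ∀ j, Tendsto (fun i => A i j) atTop (nhds (b j)))
    (hb : Tendsto b atTop (nhds 0)) {ε : ℕ → ℝ} (hε : ∀ n, 0 < ε n) (hanti : Antitone ε) :
    ∃ φ : ℕ → ℕ, StrictMono φ ∧ ∀ i j, i ≠ j → A (φ i) (φ j) ≤ ε j := by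
  obtain ⟨p, hp, hr⟩ := exists_seq_of_forall_finset_exists
    (fun x : ℕ × ℕ => b x.2 < ε x.1)
    (fun x y : ℕ × ℕ => x.1 < y.1 ∧ x.2 < y.2 ∧ A x.2 y.2 < ε y.1 ∧ A y.2 x.2 < ε x.1)
    (fun s hs => by
      obtain ⟨n, hn⟩ : ∃ n, ∀ x ∈ s, x.1 < n :=
        ⟨s.sup Prod.fst + 1, fun x hx => Nat.lt_succ_of_le (Finset.le_sup (f := Prod.fst) hx)⟩
      have h : ∀ᶠ N in atTop, b N < ε n ∧
          ∀ x ∈ s, x.2 < N ∧ A x.2 N < ε n ∧ A N x.2 < ε x.1 := by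
        refine (hb.eventually_lt_const (hε n)).and ((Finset.eventually_all s).2 fun x hx => ?_)
        exact (eventually_gt_atTop x.2).and (((hrow x.2).eventually_lt_const (hε n)).and
          ((hcol x.2).eventually_lt_const (hs x hx)))
      obtain ⟨N, hN, hN'⟩ := h.exists
      exact ⟨(n, N), hN, fun x hx => ⟨hn x hx, hN' x hx⟩⟩)
  have hidx : StrictMono fun n => (p n).1 := fun m n h => (hr m n h).1
  refine ⟨fun n => (p n).2, fun m n h => (hr m n h).2.1, fun i j hij => ?_⟩
  refine le_trans ?_ (hanti (hidx.le_apply (x := j)))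
  rcases lt_or_gt_of_ne hij with h | h
  · exact (hr i j h).2.2.1.le
  · exact (hr j i h).2.2.2.le

namespace DominatedByC0

variable {X : Type*} [NormedAddCommGroup X] [NormedSpace 𝕜 X] {f : ℕ → X}

theorem comp_injective (hf : DominatedByC0 𝕜 f) {φ : ℕ → ℕ} (hφ : Function.Injective φ) :
    DominatedByC0 𝕜 (f ∘ φ) := by
  intro t c M hM hc
  have h := hf (t.map ⟨φ, hφ⟩) (fun n => c (Function.invFun φ n)) M hM
  simp only [Finset.mem_map, Function.Embedding.coeFn_mk, forall_exists_index, and_imp,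
    forall_apply_eq_imp_iff₂, Function.leftInverse_invFun hφ _, Finset.sum_map] at h
  exact h hc

theorem smul (hf : DominatedByC0 𝕜 f) {a : ℕ → 𝕜} (ha : ∀ n, ‖a n‖ ≤ 1) :
    DominatedByC0 𝕜 fun n => a n • f n := by
  intro t c M hM hc
  simp only [smul_smul]
  refine hf t _ M hM fun m hm => ?_
  rw [norm_mul]
  exact (mul_le_of_le_one_right (norm_nonneg _) (ha m)).trans (hc m hm)

theorem summable_smul [CompleteSpace X] (hf : DominatedByC0 𝕜 f) {c : ℕ → 𝕜}
    (hc : Tendsto c atTop (nhds 0)) : Summable fun n => c n • f n := by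
  rw [summable_iff_vanishing_norm]
  intro ε hε
  have h : ∀ᶠ n in atTop, ‖c n‖ < ε / 2 :=
    (tendsto_norm_zero.comp hc).eventually_lt_const (half_pos hε)
  obtain ⟨N, hN⟩ := eventually_atTop.1 h
  refine ⟨Finset.range N, fun t ht => (hf t c (ε / 2) (half_pos hε).le fun m hm => ?_).trans_lt
    (half_lt_self hε)⟩
  refine (hN m ?_).le
  by_contra hlt
  exact Finset.disjoint_left.1 ht hm (Finset.mem_range.2 (not_le.1 hlt))

theorem norm_tsum_smul_le [CompleteSpace X] (hf : DominatedByC0 𝕜 f) {c : ℕ → 𝕜}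
    (hc : Tendsto c atTop (nhds 0)) {M : ℝ} (hM : 0 ≤ M) (hcM : ∀ n, ‖c n‖ ≤ M) :
    ‖∑' n, c n • f n‖ ≤ M :=
  le_of_tendsto (hf.summable_smul hc).hasSum.norm
    (Eventually.of_forall fun t => hf t c M hM fun m _ => hcM m)

theorem tendsto_dual_apply (hf : DominatedByC0 𝕜 f) (g : X →L[𝕜] 𝕜) :
    Tendsto (fun n => g (f n)) atTop (nhds 0) := by
  choose u hu huv using fun m => RCLike.exists_norm_eq_mul_self (g (f m))
  have hs : Summable fun n => ‖g (f n)‖ := by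
    refine summable_of_sum_le (c := ‖g‖) (fun _ => norm_nonneg _) fun t => ?_
    have h1 : ((∑ m ∈ t, ‖g (f m)‖ : ℝ) : 𝕜) = g (∑ m ∈ t, u m • f m) := by
      rw [map_sum, RCLike.ofReal_sum]
      refine Finset.sum_congr rfl fun m _ => ?_
      rw [huv, map_smul, smul_eq_mul]
    calc ∑ m ∈ t, ‖g (f m)‖ = ‖((∑ m ∈ t, ‖g (f m)‖ : ℝ) : 𝕜)‖ := by
          rw [RCLike.norm_ofReal, abs_of_nonneg (Finset.sum_nonneg fun _ _ => norm_nonneg _)]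
      _ ≤ ‖g‖ := by
          rw [h1]
          exact g.unit_le_opNorm _ (hf t u 1 zero_le_one fun m _ => (hu m).le)
  exact tendsto_zero_iff_norm_tendsto_zero.2 hs.tendsto_atTop_zero

/-- The coefficients `(x₀, -x₀, x₁, -x₁, …)`. -/
theorem tendsto_alternating_double (x : C₀(ℕ, 𝕜)) :
    Tendsto (fun j : ℕ => (-1 : 𝕜) ^ j * x (j / 2)) atTop (nhds 0) := by
  have h : Tendsto (fun j : ℕ => j / 2) atTop atTop :=
    Nat.tendsto_div_const_atTop two_ne_zero
  rw [tendsto_zero_iff_norm_tendsto_zero]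
  simpa using tendsto_zero_iff_norm_tendsto_zero.1 (x.tendsto_atTop.comp h)

theorem norm_alternating_double_le (x : C₀(ℕ, 𝕜)) (j : ℕ) :
    ‖(-1 : 𝕜) ^ j * x (j / 2)‖ ≤ ‖x‖ := by
  simpa using x.norm_apply_le (j / 2)

/-- The operator `c₀ → X` mapping the `n`-th unit vector to `f (2 * n) - f (2 * n + 1)`. -/
noncomputable def pairDifference [CompleteSpace X] (hf : DominatedByC0 𝕜 f) :
    C₀(ℕ, 𝕜) →L[𝕜] X :=
  LinearMap.mkContinuous
    { toFun := fun x => ∑' j : ℕ, ((-1 : 𝕜) ^ j * x (j / 2)) • f j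
      map_add' := fun x y => by
        rw [← (hf.summable_smul (tendsto_alternating_double x)).tsum_add
          (hf.summable_smul (tendsto_alternating_double y))]
        simp only [ZeroAtInftyContinuousMap.add_apply, mul_add, add_smul]
      map_smul' := fun a x => by
        rw [RingHom.id_apply,
          ← (hf.summable_smul (tendsto_alternating_double x)).tsum_const_smul a]
        simp only [ZeroAtInftyContinuousMap.smul_apply, smul_smul, smul_eq_mul, mul_left_comm] }
    1 fun x => by
      rw [one_mul]
      exact hf.norm_tsum_smul_le (tendsto_alternating_double x) (norm_nonneg x)
        (norm_alternating_double_le x)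

theorem norm_pairDifference_le [CompleteSpace X] (hf : DominatedByC0 𝕜 f) :
    ‖hf.pairDifference‖ ≤ 1 :=
  LinearMap.mkContinuous_norm_le _ zero_le_one _

theorem norm_dual_pairDifference_sub_le [CompleteSpace X] (hf : DominatedByC0 𝕜 f)
    (g : X →L[𝕜] 𝕜) (i : ℕ) {ε : ℕ → ℝ} {s : ℝ} (hε : HasSum ε s) (hε0 : ∀ j, 0 ≤ ε j)
    (hg : ∀ j, i ≠ j → ‖g (f j)‖ ≤ ε j) (x : C₀(ℕ, 𝕜)) :
    ‖g (hf.pairDifference x) - (-1 : 𝕜) ^ i * x (i / 2) * g (f i)‖ ≤ ‖x‖ * s := by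
  have h1 : HasSum (fun j : ℕ => (-1 : 𝕜) ^ j * x (j / 2) * g (f j)) (g (hf.pairDifference x)) := by
    have h := g.hasSum (hf.summable_smul (tendsto_alternating_double x)).hasSum
    simp only [map_smul, smul_eq_mul] at h
    exact h
  refine (hasSum_ite_sub_hasSum h1 i).norm_le_of_bounded (hε.mul_left ‖x‖) fun j => ?_
  split_ifs with hj
  · simpa using mul_nonneg (norm_nonneg x) (hε0 j)
  · rw [norm_mul]
    exact mul_le_mul (norm_alternating_double_le x j) (hg j (Ne.symm hj)) (norm_nonneg _)
      (norm_nonneg _)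

end DominatedByC0

/-- The operator into `c₀` given by a bounded weak*-null sequence of functionals. -/
noncomputable def c0OfDual {Y : Type*} [NormedAddCommGroup Y] [NormedSpace 𝕜 Y]
    (h : ℕ → (Y →L[𝕜] 𝕜)) (hh : ∀ n, ‖h n‖ ≤ 1)
    (h0 : ∀ y, Tendsto (fun n => h n y) atTop (nhds 0)) : Y →L[𝕜] C₀(ℕ, 𝕜) :=
  LinearMap.mkContinuous
    { toFun := fun y =>
        { toFun := fun n => h n y
          continuous_toFun := continuous_of_discreteTopology
          zero_at_infty' := by rw [cocompact_eq_atTop]; exact h0 y }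
      map_add' := fun y z => ZeroAtInftyContinuousMap.ext fun n => map_add (h n) y z
      map_smul' := fun a y => ZeroAtInftyContinuousMap.ext fun n => map_smul (h n) a y }
    1 fun y => (ZeroAtInftyContinuousMap.norm_le_iff _ (by positivity)).2 fun n =>
      (h n).le_of_opNorm_le (hh n) y

theorem norm_c0OfDual_le {Y : Type*} [NormedAddCommGroup Y] [NormedSpace 𝕜 Y]
    (h : ℕ → (Y →L[𝕜] 𝕜)) (hh : ∀ n, ‖h n‖ ≤ 1)
    (h0 : ∀ y, Tendsto (fun n => h n y) atTop (nhds 0)) : ‖c0OfDual h hh h0‖ ≤ 1 :=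
  LinearMap.mkContinuous_norm_le _ zero_le_one _

theorem exists_leftInverse_of_norm_sub_le {E Z : Type*} [NormedAddCommGroup E] [NormedSpace 𝕜 E]
    [CompleteSpace E] [NormedAddCommGroup Z] [NormedSpace 𝕜 Z] (U : Z →L[𝕜] E) (W : E →L[𝕜] Z)
    {δ η : ℝ} (hδ : 0 < δ) (hη : 0 ≤ η) (hη1 : η < 1) (hU : ‖U‖ ≤ 1)
    (h : ∀ x, ‖U (W x) - (δ : 𝕜) • x‖ ≤ δ * η * ‖x‖) :
    ∃ U' : Z →L[𝕜] E, U' ∘L W = ContinuousLinearMap.id 𝕜 E ∧ ‖U'‖ ≤ 1 / (δ * (1 - η)) := by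
  have hδ' : (δ : 𝕜) ≠ 0 := RCLike.ofReal_ne_zero.2 hδ.ne'
  have hη' : 0 < 1 - η := sub_pos.2 hη1
  let R : E →L[𝕜] E := 1 - (δ : 𝕜)⁻¹ • (U ∘L W)
  have hR : ‖R‖ ≤ η := by
    refine R.opNorm_le_bound hη fun x => ?_
    have : R x = -((δ : 𝕜)⁻¹ • (U (W x) - (δ : 𝕜) • x)) := by
      simp only [R, smul_sub, smul_smul, inv_mul_cancel₀ hδ', one_smul, neg_sub]
      rfl
    rw [this, norm_neg, norm_smul, norm_inv, RCLike.norm_ofReal, abs_of_pos hδ,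
      inv_mul_le_iff₀ hδ, ← mul_assoc]
    exact h x
  obtain ⟨S, hS⟩ := isUnit_one_sub_of_norm_lt_one (hR.trans_lt hη1)
  have hS' : (S : E →L[𝕜] E) = (δ : 𝕜)⁻¹ • (U ∘L W) := by rw [hS]; exact sub_sub_cancel _ _
  let L : E →L[𝕜] E := ↑S⁻¹
  have hL : ∀ x, (1 - η) * ‖L x‖ ≤ ‖x‖ := fun x => by
    have e : (1 - R) (L x) = x := by
      rw [← hS]
      exact congrArg (fun A : E →L[𝕜] E => A x) S.mul_inv
    have e' : L x = x + R (L x) := sub_eq_iff_eq_add.1 e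
    have := calc ‖L x‖ = ‖x + R (L x)‖ := congrArg norm e'
      _ ≤ ‖x‖ + η * ‖L x‖ := (norm_add_le _ _).trans (by gcongr; exact R.le_of_opNorm_le hR _)
    linarith
  refine ⟨L ∘L ((δ : 𝕜)⁻¹ • U), ?_, ?_⟩
  · ext x
    have := congrArg (fun A : E →L[𝕜] E => A x) S.inv_mul
    rw [hS'] at this
    exact this
  · refine ContinuousLinearMap.opNorm_le_bound _ (by positivity) fun z => ?_
    rw [one_div_mul_eq_div, le_div_iff₀ (by positivity)]
    calc ‖L ((δ : 𝕜)⁻¹ • U z)‖ * (δ * (1 - η)) = δ * ((1 - η) * ‖L ((δ : 𝕜)⁻¹ • U z)‖) := by ring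
      _ ≤ δ * ‖(δ : 𝕜)⁻¹ • U z‖ := by gcongr; exact hL _
      _ = ‖U z‖ := by
        rw [norm_smul, norm_inv, RCLike.norm_ofReal, abs_of_pos hδ, mul_inv_cancel_left₀ hδ.ne']
      _ ≤ ‖z‖ := by simpa using U.le_of_opNorm_le hU z

theorem DominatedByC0.exists_factorization {X Y : Type*} [NormedAddCommGroup X] [NormedSpace 𝕜 X]
    [CompleteSpace X] [NormedAddCommGroup Y] [NormedSpace 𝕜 Y]
    (hY : ∀ g : ℕ → (Y →L[𝕜] 𝕜), (∀ n, ‖g n‖ ≤ 1) →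
      ∃ ρ : ℕ → ℕ, StrictMono ρ ∧ ∃ g₀ : Y →L[𝕜] 𝕜, ‖g₀‖ ≤ 1 ∧
        ∀ y : Y, Tendsto (fun n => g (ρ n) y) atTop (nhds (g₀ y)))
    (T : X →L[𝕜] Y) {f : ℕ → X} (hf : DominatedByC0 𝕜 f) {δ η : ℝ} (hδ : 0 < δ)
    (hTf : ∀ n, ‖T (f n)‖ = δ) (hη : 0 < η) (hη1 : η < 1) :
    ∃ (U : Y →L[𝕜] C₀(ℕ, 𝕜)) (V : C₀(ℕ, 𝕜) →L[𝕜] X),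
      U ∘L T ∘L V = ContinuousLinearMap.id 𝕜 (C₀(ℕ, 𝕜)) ∧ ‖U‖ ≤ 1 / (δ * (1 - η)) ∧ ‖V‖ ≤ 1 := by
  choose g hg hgT using fun n => exists_dual_vector'' 𝕜 (T (f n))
  obtain ⟨ρ, hρ, g₀, -, hg₀⟩ := hY g hg
  have hfρ := hf.comp_injective hρ.injective
  let ε : ℕ → ℝ := fun n => δ * η / 2 / 2 ^ n
  have hε : ∀ n, 0 < ε n := fun n => by positivity
  obtain ⟨φ, hφ, hoff⟩ := exists_strictMono_offDiag_le
    (A := fun i j => ‖g (ρ i) (T (f (ρ j)))‖) (b := fun j => ‖g₀ (T (f (ρ j)))‖) (ε := ε)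
    (fun i => tendsto_zero_iff_norm_tendsto_zero.1 (hfρ.tendsto_dual_apply (g (ρ i) ∘L T)))
    (fun j => (hg₀ _).norm)
    (tendsto_zero_iff_norm_tendsto_zero.1 (hfρ.tendsto_dual_apply (g₀ ∘L T))) hε
    (fun m n hmn => by
      have : (2 : ℝ) ^ m ≤ 2 ^ n := pow_le_pow_right₀ one_le_two hmn
      simp only [ε]; gcongr)
  have hF := hfρ.comp_injective hφ.injective
  let G : ℕ → (Y →L[𝕜] 𝕜) := fun i => g (ρ (φ i))
  have hG : ∀ y, Tendsto (fun n => G n y) atTop (nhds (g₀ y)) := fun y =>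
    (hg₀ y).comp hφ.tendsto_atTop
  let h : ℕ → (Y →L[𝕜] 𝕜) := fun n => (2 : 𝕜)⁻¹ • (G (2 * n) - G (2 * n + 1))
  have h_norm : ∀ n, ‖h n‖ ≤ 1 := fun n => by
    have h1 : ‖G (2 * n) - G (2 * n + 1)‖ ≤ 1 + 1 := norm_sub_le_of_le (hg _) (hg _)
    rw [norm_smul, norm_inv, RCLike.norm_ofNat]
    linarith
  have h_tendsto : ∀ y, Tendsto (fun n => h n y) atTop (nhds 0) := fun y => by
    have he : Tendsto (fun n : ℕ => 2 * n) atTop atTop :=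
      tendsto_atTop_mono (fun n => by simp only [id]; lia) tendsto_id
    have ho : Tendsto (fun n : ℕ => 2 * n + 1) atTop atTop :=
      tendsto_atTop_mono (fun n => by simp only [id]; lia) tendsto_id
    have := (((hG y).comp he).sub ((hG y).comp ho)).const_smul (2 : 𝕜)⁻¹
    rw [sub_self, smul_zero] at this
    exact this
  obtain ⟨U, hU, hUn⟩ := exists_leftInverse_of_norm_sub_le (c0OfDual h h_norm h_tendsto)
    (T ∘L hF.pairDifference) hδ hη.le hη1 (norm_c0OfDual_le h h_norm h_tendsto) fun x => by
      rw [ZeroAtInftyContinuousMap.norm_le_iff _ (by positivity)]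
      intro n
      have est : ∀ i, ‖G i (T (hF.pairDifference x)) - (-1 : 𝕜) ^ i * x (i / 2) * (δ : 𝕜)‖ ≤
          ‖x‖ * (δ * η) := fun i => by
        have e : G i (T (f (ρ (φ i)))) = (δ : 𝕜) := by rw [hgT, hTf]
        rw [← e]
        exact hF.norm_dual_pairDifference_sub_le (G i ∘L T) i (hasSum_geometric_two' (δ * η))
          (fun j => (hε j).le) (fun j hij => hoff i j hij) x
      have e0 := est (2 * n)
      have e1 := est (2 * n + 1)
      rw [show 2 * n / 2 = n by lia, pow_mul, neg_one_sq, one_pow, one_mul] at e0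
      rw [show (2 * n + 1) / 2 = n by lia, pow_succ, pow_mul, neg_one_sq, one_pow, one_mul] at e1
      have e2 := norm_sub_le_of_le e0 e1
      have e3 : (c0OfDual h h_norm h_tendsto ((T ∘L hF.pairDifference) x) - (δ : 𝕜) • x) n =
          (2 : 𝕜)⁻¹ * ((G (2 * n) (T (hF.pairDifference x)) - x n * (δ : 𝕜)) -
            (G (2 * n + 1) (T (hF.pairDifference x)) - -1 * x n * (δ : 𝕜))) := by
        change (2 : 𝕜)⁻¹ * (G (2 * n) (T (hF.pairDifference x)) -
          G (2 * n + 1) (T (hF.pairDifference x))) - (δ : 𝕜) * x n = _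
        field_simp
        ring
      rw [e3, norm_mul, norm_inv, RCLike.norm_ofNat]
      linarith
  exact ⟨U, hF.pairDifference, hU, hUn, hF.norm_pairDifference_le⟩

end

/-- Let `K` be a locally compact Hausdorff space, `Y` a Banach space whose
dual unit ball is weak* sequentially compact, `T : C₀(K) → Y` a bounded operator and
`C > 0`. Then `C₀(K)` contains a sequence `(fₙ)` with `sup_k Σₙ |fₙ(k)| ≤ 1` and
`inf_n ‖T fₙ‖ > 1/C` if and only if there are operators `U : Y → c₀`, `V : c₀ → C₀(K)`
with `U ∘ T ∘ V = I_{c₀}` and `‖U‖·‖V‖ < C`. -/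
theorem statement9 {𝕜 : Type*} [RCLike 𝕜] {K : Type*} [TopologicalSpace K]
    [LocallyCompactSpace K] [T2Space K]
    {Y : Type*} [NormedAddCommGroup Y] [NormedSpace 𝕜 Y] [CompleteSpace Y]
    (hY : ∀ g : ℕ → (Y →L[𝕜] 𝕜), (∀ n, ‖g n‖ ≤ 1) →
      ∃ ρ : ℕ → ℕ, StrictMono ρ ∧ ∃ g₀ : Y →L[𝕜] 𝕜, ‖g₀‖ ≤ 1 ∧
        ∀ y : Y, Tendsto (fun n => g (ρ n) y) atTop (nhds (g₀ y)))
    (T : C₀(K, 𝕜) →L[𝕜] Y) (C : ℝ) (hC : 0 < C) :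
    (∃ f : ℕ → C₀(K, 𝕜),
        (∀ k : K, ∑' n : ℕ, (‖f n k‖₊ : ℝ≥0∞) ≤ 1) ∧ 1 / C < ⨅ n : ℕ, ‖T (f n)‖) ↔
      ∃ (U : Y →L[𝕜] C₀(ℕ, 𝕜)) (V : C₀(ℕ, 𝕜) →L[𝕜] C₀(K, 𝕜)),
        U ∘L T ∘L V = ContinuousLinearMap.id 𝕜 (C₀(ℕ, 𝕜)) ∧ ‖U‖ * ‖V‖ < C := by
  constructor
  · rintro ⟨f, hf, hinf⟩
    obtain ⟨δ, hCδ, hδinf⟩ := exists_between hinf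
    have hδ : 0 < δ := (one_div_pos.2 hC).trans hCδ
    have hTf : ∀ n, δ ≤ ‖T (f n)‖ := fun n =>
      hδinf.le.trans (ciInf_le ⟨0, by rintro _ ⟨m, rfl⟩; exact norm_nonneg _⟩ n)
    have hpos : ∀ n, 0 < ‖T (f n)‖ := fun n => hδ.trans_le (hTf n)
    have hscale : ∀ n, ‖((δ / ‖T (f n)‖ : ℝ) : 𝕜)‖ = δ / ‖T (f n)‖ := fun n => by
      rw [RCLike.norm_ofReal, abs_of_pos (div_pos hδ (hpos n))]
    have hCδ' : 1 < δ * C := (div_lt_iff₀ hC).1 hCδ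
    obtain ⟨η, hη, hη'⟩ : ∃ η : ℝ, 0 < η ∧ η < 1 - 1 / (δ * C) :=
      exists_between (sub_pos.2 ((div_lt_one (one_pos.trans hCδ')).2 hCδ'))
    have hη1 : η < 1 := hη'.trans (sub_lt_self _ (by positivity))
    obtain ⟨U, V, hUV, hU, hV⟩ := ((dominatedByC0_of_tsum_le_one hf).smul
      (a := fun n => ((δ / ‖T (f n)‖ : ℝ) : 𝕜))
      (fun n => by rw [hscale]; exact (div_le_one (hpos n)).2 (hTf n))).exists_factorization
      hY T hδ (fun n => by rw [map_smul, norm_smul, hscale, div_mul_cancel₀ _ (hpos n).ne'])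
      hη hη1
    refine ⟨U, V, hUV, (mul_le_of_le_one_right (norm_nonneg U) hV).trans_lt (hU.trans_lt ?_)⟩
    have h1 : 1 / (δ * C) < 1 - η := by linarith
    rw [div_lt_iff₀ (by positivity)] at h1
    rw [div_lt_iff₀ (mul_pos hδ (sub_pos.2 hη1))]
    linarith
  · rintro ⟨U, V, hUV, hlt⟩
    exact exists_tsum_le_one_of_factorization T U V hUV hlt
end
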